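/- arXiv:1907.10101 — 6 statements merged into one kernel-verified Lean document; each statement's English description precedes it below -/
import Mathlib

section
/- In any routing game with continuous, nonnegative, nondecreasing edge costs, the Beckmann potential V is convex on (0,∞) and differentiable at every μ > 0, and for every μ > 0 and every Wardrop equilibrium f at demand μ with equilibrium cost λ one has V'(μ) = λ; consequently μ ↦ V'(μ) is continuous and nondecreasing on (0,∞). -/
open Finset Set

noncomputable section

variable {E P : Type*}

/-- The load induced on edge `e` by a path-flow `f`. -/
def edgeLoad [Fintype P] [DecidableEq E] (path : P → Finset E) (f : P → ℝ) (e : E) : ℝ :=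
  ∑ p, if e ∈ path p then f p else 0

/-- A flow is feasible for demand `μ` if it is nonnegative and routes total demand `μ`. -/
def Feasible [Fintype P] (f : P → ℝ) (μ : ℝ) : Prop :=
  (∀ p, 0 ≤ f p) ∧ ∑ p, f p = μ

/-- The cost of path `p` under flow `f`. -/
def pathCost [Fintype P] [DecidableEq E] (path : P → Finset E) (c : E → ℝ → ℝ)
    (f : P → ℝ) (p : P) : ℝ :=
  ∑ e ∈ path p, c e (edgeLoad path f e)

/-- Wardrop equilibrium with equilibrium cost `lam` at demand `μ`. -/
def IsWardrop [Fintype P] [DecidableEq E] (path : P → Finset E) (c : E → ℝ → ℝ)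
    (μ : ℝ) (f : P → ℝ) (lam : ℝ) : Prop :=
  Feasible f μ ∧ (∀ p, 0 < f p → pathCost path c f p = lam) ∧
    ∀ p, lam ≤ pathCost path c f p

/-- Social cost of a flow. -/
def socialCost [Fintype E] [Fintype P] [DecidableEq E] (path : P → Finset E)
    (c : E → ℝ → ℝ) (f : P → ℝ) : ℝ :=
  ∑ e, edgeLoad path f e * c e (edgeLoad path f e)

/-- The active network: edges lying on some path of cost `lam` (the minimal cost). -/
def activeNet [Fintype P] [DecidableEq E] (path : P → Finset E) (c : E → ℝ → ℝ)
    (f : P → ℝ) (lam : ℝ) : Set E :=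
  {e | ∃ p, pathCost path c f p = lam ∧ e ∈ path p}

/-- `μ₀` is a breakpoint of the active-network map `Act`. -/
def IsBreakpoint (Act : ℝ → Set E) (μ₀ : ℝ) : Prop :=
  0 < μ₀ ∧ ∃ ε > 0,
    (∀ μ ∈ Set.Ico (μ₀ - ε) μ₀, Act μ = Act (μ₀ - ε)) ∧
    (∀ μ ∈ Set.Ioc μ₀ (μ₀ + ε), Act μ = Act (μ₀ + ε)) ∧
    Act (μ₀ - ε) ≠ Act (μ₀ + ε)

/-- The Beckmann objective of a path-flow: the sum over edges of the integrated edge costs. -/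
def beckmannObjective [Fintype E] [Fintype P] [DecidableEq E] (path : P → Finset E)
    (c : E → ℝ → ℝ) (f : P → ℝ) : ℝ :=
  ∑ e, ∫ s in (0:ℝ)..(edgeLoad path f e), c e s

theorem hasDerivAt_of_squeeze {f g h : ℝ → ℝ} {d x : ℝ} (hg : HasDerivAt g d x)
    (hh : HasDerivAt h d x) (hgx : g x = f x) (hhx : h x = f x)
    (hgf : ∀ᶠ y in nhds x, g y ≤ f y) (hfh : ∀ᶠ y in nhds x, f y ≤ h y) :
    HasDerivAt f d x := by
  rw [hasDerivAt_iff_isLittleO] at *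
  refine Asymptotics.isLittleO_iff.2 fun ε hε => ?_
  filter_upwards [hgf, hfh, Asymptotics.isLittleO_iff.1 hg hε,
    Asymptotics.isLittleO_iff.1 hh hε] with y h₁ h₂ h₃ h₄
  rw [Real.norm_eq_abs, abs_le] at *
  rw [hgx] at h₃
  rw [hhx] at h₄
  exact ⟨by linarith [h₃.1], by linarith [h₄.2]⟩

/-- A convex function touched from above at an interior point by a differentiable function is
differentiable there, with the same derivative. -/
theorem ConvexOn.hasDerivAt_of_eventually_le {s : Set ℝ} {f φ : ℝ → ℝ} {d x : ℝ}
    (hf : ConvexOn ℝ s f) (hs : s ∈ nhds x) (hφ : HasDerivAt φ d x) (hφx : φ x = f x)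
    (hle : ∀ᶠ y in nhds x, f y ≤ φ y) : HasDerivAt f d x := by
  have hrefl : Filter.Tendsto (fun y => 2 * x - y) (nhds x) (nhds x) := by
    have : Continuous fun y : ℝ => 2 * x - y := by fun_prop
    simpa [two_mul] using this.tendsto x
  have hψ : HasDerivAt (fun y => 2 * f x - φ (2 * x - y)) d x := by
    have h₁ : HasDerivAt (fun y => 2 * x - y) (-1) x := (hasDerivAt_id x).const_sub (2 * x)
    have h₂ : HasDerivAt φ d (2 * x - x) := by simpa [two_mul] using hφ
    simpa using (h₂.comp x h₁).const_sub (2 * f x)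
  refine hasDerivAt_of_squeeze hψ hφ ?_ hφx ?_ hle
  · simp only [two_mul, add_sub_cancel_right, hφx]
  · filter_upwards [hs, hrefl hs, hrefl.eventually hle] with y hy hy' hle'
    have := hf.2 hy hy' (by norm_num : (0:ℝ) ≤ 1 / 2) (by norm_num : (0:ℝ) ≤ 1 / 2) (by norm_num)
    simp only [smul_eq_mul] at this
    rw [show 1 / 2 * y + 1 / 2 * (2 * x - y) = x by ring] at this
    linarith

theorem MonotoneOn.continuousOn_of_ordConnected_image {s : Set ℝ} {g : ℝ → ℝ}
    (hg : MonotoneOn g s) (hs : IsOpen s) (himg : (g '' s).OrdConnected) :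
    ContinuousOn g s := by
  intro x hx
  refine ContinuousAt.continuousWithinAt (tendsto_order.2 ⟨fun b hb => ?_, fun b hb => ?_⟩)
  · suffices ∃ z ∈ s, z < x ∧ b < g z by
      obtain ⟨z, hz, hzx, hbz⟩ := this
      filter_upwards [hs.mem_nhds hx, lt_mem_nhds hzx] with y hy hzy
      exact hbz.trans_le (hg hz hy hzy.le)
    obtain ⟨w, hwx, hw⟩ := exists_Ioc_subset_of_mem_nhds (hs.mem_nhds hx) ⟨x - 1, by linarith⟩
    obtain ⟨u, hwu, hux⟩ := exists_between hwx
    have hu : u ∈ s := hw ⟨hwu, hux.le⟩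
    by_cases hbu : b < g u
    · exact ⟨u, hu, hux, hbu⟩
    obtain ⟨v, hbv, hvx⟩ := exists_between hb
    obtain ⟨z, hz, rfl⟩ := himg.out (mem_image_of_mem g hu) (mem_image_of_mem g hx)
      ⟨(not_lt.1 hbu).trans hbv.le, hvx.le⟩
    exact ⟨z, hz, not_le.1 fun h => hvx.not_ge (hg hx hz h), hbv⟩
  · suffices ∃ z ∈ s, x < z ∧ g z < b by
      obtain ⟨z, hz, hxz, hzb⟩ := this
      filter_upwards [hs.mem_nhds hx, gt_mem_nhds hxz] with y hy hyz
      exact (hg hy hz hyz.le).trans_lt hzb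
    obtain ⟨w, hxw, hw⟩ := exists_Ico_subset_of_mem_nhds (hs.mem_nhds hx) ⟨x + 1, by linarith⟩
    obtain ⟨u, hxu, huw⟩ := exists_between hxw
    have hu : u ∈ s := hw ⟨hxu.le, huw⟩
    by_cases hub : g u < b
    · exact ⟨u, hu, hxu, hub⟩
    obtain ⟨v, hxv, hvb⟩ := exists_between hb
    obtain ⟨z, hz, rfl⟩ := himg.out (mem_image_of_mem g hx) (mem_image_of_mem g hu)
      ⟨hxv.le, hvb.le.trans (not_lt.1 hub)⟩
    exact ⟨z, hz, not_le.1 fun h => hxv.not_ge (hg hz hx h), hvb⟩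

theorem ConvexOn.continuousOn_deriv_of_isOpen {s : Set ℝ} {f : ℝ → ℝ} (hf : ConvexOn ℝ s f)
    (hs : IsOpen s) (hd : ∀ x ∈ s, DifferentiableAt ℝ f x) : ContinuousOn (deriv f) s :=
  (hf.monotoneOn_deriv hd).continuousOn_of_ordConnected_image hs
    (hf.1.ordConnected.image_deriv hd)

theorem Continuous.hasDerivAt_integral_zero {c : ℝ → ℝ} (hc : Continuous c) (x : ℝ) :
    HasDerivAt (fun t => ∫ s in (0:ℝ)..t, c s) (c x) x :=
  (hc.integral_hasStrictDerivAt 0 x).hasDerivAt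

theorem Monotone.convexOn_integral_zero {c : ℝ → ℝ} (hm : Monotone c) (hc : Continuous c) :
    ConvexOn ℝ univ fun t => ∫ s in (0:ℝ)..t, c s := by
  refine Monotone.convexOn_univ_of_deriv
    (fun x => (hc.hasDerivAt_integral_zero x).differentiableAt) ?_
  rwa [funext fun x => (hc.hasDerivAt_integral_zero x).deriv]

theorem Monotone.mul_sub_le_integral_sub {c : ℝ → ℝ} (hm : Monotone c) (hc : Continuous c)
    (x y : ℝ) :
    c x * (y - x) ≤ (∫ s in (0:ℝ)..y, c s) - ∫ s in (0:ℝ)..x, c s := by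
  have hconv := hm.convexOn_integral_zero hc
  rcases lt_trichotomy x y with h | rfl | h
  · have := hconv.le_slope_of_hasDerivAt (mem_univ x) (mem_univ y) h
      (hc.hasDerivAt_integral_zero x)
    rwa [slope_def_field, le_div_iff₀ (sub_pos.2 h)] at this
  · simp
  · have := hconv.slope_le_of_hasDerivAt (mem_univ y) (mem_univ x) h
      (hc.hasDerivAt_integral_zero x)
    rw [slope_def_field, div_le_iff₀ (sub_pos.2 h)] at this
    linarith

section Flow

variable [Fintype P] [DecidableEq E] (path : P → Finset E)

theorem edgeLoad_add (f g : P → ℝ) (e : E) :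
    edgeLoad path (f + g) e = edgeLoad path f e + edgeLoad path g e := by
  simp only [edgeLoad, ← Finset.sum_add_distrib]
  exact Finset.sum_congr rfl fun p _ => by split_ifs <;> simp

theorem edgeLoad_smul (a : ℝ) (f : P → ℝ) (e : E) :
    edgeLoad path (a • f) e = a * edgeLoad path f e := by
  simp only [edgeLoad, Finset.mul_sum]
  exact Finset.sum_congr rfl fun p _ => by split_ifs <;> simp

theorem edgeLoad_single [DecidableEq P] (p : P) (t : ℝ) (e : E) :
    edgeLoad path (Pi.single p t) e = if e ∈ path p then t else 0 := by
  rw [edgeLoad, Finset.sum_eq_single p] <;> simp +contextual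

/-- Summing edge weights against the loads of a flow is the same as summing path weights against
the flow itself. -/
theorem sum_mul_edgeLoad [Fintype E] (w : E → ℝ) (f : P → ℝ) :
    ∑ e, w e * edgeLoad path f e = ∑ p, (∑ e ∈ path p, w e) * f p := by
  simp only [edgeLoad, Finset.mul_sum, Finset.sum_mul]
  rw [Finset.sum_comm]
  refine Finset.sum_congr rfl fun p _ => ?_
  simp [mul_ite, Finset.sum_ite_mem]

end Flow

theorem Feasible.smul_add_smul [Fintype P] {f g : P → ℝ} {μ ν a b : ℝ} (hf : Feasible f μ)
    (hg : Feasible g ν) (ha : 0 ≤ a) (hb : 0 ≤ b) :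
    Feasible (a • f + b • g) (a * μ + b * ν) := by
  refine ⟨fun p => add_nonneg (mul_nonneg ha (hf.1 p)) (mul_nonneg hb (hg.1 p)), ?_⟩
  simp [Finset.sum_add_distrib, ← Finset.mul_sum, hf.2, hg.2]

theorem Feasible.add_single [Fintype P] [DecidableEq P] {f : P → ℝ} {μ t : ℝ} {p : P}
    (hf : Feasible f μ) (ht : -f p ≤ t) : Feasible (f + Pi.single p t) (μ + t) := by
  refine ⟨fun q => ?_, by simp [Finset.sum_add_distrib, hf.2]⟩
  rcases eq_or_ne q p with rfl | hq
  · simp only [Pi.add_apply, Pi.single_eq_same]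
    linarith
  · simpa [hq] using hf.1 q

theorem Feasible.exists_pos [Fintype P] {f : P → ℝ} {μ : ℝ} (hf : Feasible f μ) (hμ : 0 < μ) :
    ∃ p, 0 < f p := by
  by_contra! h
  have := Finset.sum_nonpos fun p (_ : p ∈ Finset.univ) => h p
  linarith [hf.2]

section Objective

variable [Fintype E] [DecidableEq E] [Fintype P] {path : P → Finset E} {c : E → ℝ → ℝ}

theorem beckmannObjective_smul_add_smul_le (hc_cont : ∀ e, Continuous (c e))
    (hc_mono : ∀ e, Monotone (c e)) (f g : P → ℝ) {a b : ℝ} (ha : 0 ≤ a) (hb : 0 ≤ b)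
    (hab : a + b = 1) :
    beckmannObjective path c (a • f + b • g) ≤
      a * beckmannObjective path c f + b * beckmannObjective path c g := by
  simp only [beckmannObjective, Finset.mul_sum, ← Finset.sum_add_distrib, edgeLoad_add,
    edgeLoad_smul]
  exact Finset.sum_le_sum fun e _ =>
    ((hc_mono e).convexOn_integral_zero (hc_cont e)).2 (mem_univ _) (mem_univ _) ha hb hab

theorem hasDerivAt_beckmannObjective_add_single [DecidableEq P]
    (hc_cont : ∀ e, Continuous (c e)) (f : P → ℝ) (p : P) :
    HasDerivAt (fun t => beckmannObjective path c (f + Pi.single p t)) (pathCost path c f p) 0 := by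
  have hedge : ∀ e, HasDerivAt
      (fun t => ∫ s in (0:ℝ)..(edgeLoad path (f + Pi.single p t) e), c e s)
      (if e ∈ path p then c e (edgeLoad path f e) else 0) 0 := by
    intro e
    simp only [edgeLoad_add, edgeLoad_single]
    split_ifs
    · have h₁ : HasDerivAt (fun t : ℝ => edgeLoad path f e + t) 1 0 :=
        (hasDerivAt_id (0:ℝ)).const_add _
      have h₂ := (hc_cont e).hasDerivAt_integral_zero (edgeLoad path f e + 0)
      simpa [Function.comp_def] using h₂.comp (0:ℝ) h₁
    · exact hasDerivAt_const _ _
  have := HasDerivAt.fun_sum fun e (_ : e ∈ Finset.univ) => hedge e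
  simpa [beckmannObjective, pathCost, Finset.sum_ite_mem] using this

theorem IsWardrop.beckmannObjective_le (hc_cont : ∀ e, Continuous (c e))
    (hc_mono : ∀ e, Monotone (c e)) {μ lam : ℝ} {f g : P → ℝ} (hf : IsWardrop path c μ f lam)
    (hg : Feasible g μ) : beckmannObjective path c f ≤ beckmannObjective path c g := by
  obtain ⟨hfeas, hused, hmin⟩ := hf
  have htangent : ∑ e, c e (edgeLoad path f e) * (edgeLoad path g e - edgeLoad path f e) ≤
      beckmannObjective path c g - beckmannObjective path c f := by
    rw [beckmannObjective, beckmannObjective, ← Finset.sum_sub_distrib]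
    exact Finset.sum_le_sum fun e _ => (hc_mono e).mul_sub_le_integral_sub (hc_cont e) _ _
  simp only [mul_sub, Finset.sum_sub_distrib, sum_mul_edgeLoad] at htangent
  have hcost_f : ∑ p, (∑ e ∈ path p, c e (edgeLoad path f e)) * f p = lam * μ := by
    rw [← hfeas.2, Finset.mul_sum]
    refine Finset.sum_congr rfl fun p _ => ?_
    rcases (hfeas.1 p).eq_or_lt with h | h
    · simp [← h]
    · rw [← hused p h, pathCost]
  have hcost_g : lam * μ ≤ ∑ p, (∑ e ∈ path p, c e (edgeLoad path f e)) * g p := by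
    rw [← hg.2, Finset.mul_sum]
    exact Finset.sum_le_sum fun p _ => mul_le_mul_of_nonneg_right (hmin p) (hg.1 p)
  linarith

end Objective

/-- the Beckmann potential `V` is convex on `(0,∞)`, differentiable at every
`μ > 0` with derivative equal to the equilibrium cost, hence `V'` is continuous and
nondecreasing on `(0,∞)`. -/
theorem beckmann_potential_C1
    [Fintype E] [DecidableEq E] [Nonempty E] [Fintype P] [Nonempty P]
    (path : P → Finset E) (hpath : ∀ p, (path p).Nonempty)
    (c : E → ℝ → ℝ)
    (hc_cont : ∀ e, Continuous (c e))
    (hc_nonneg : ∀ e x, 0 ≤ c e x)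
    (hc_mono : ∀ e, Monotone (c e))
    (V : ℝ → ℝ)
    (hV : ∀ μ : ℝ, 0 ≤ μ →
      IsLeast {y | ∃ f, Feasible f μ ∧
        y = ∑ e, ∫ s in (0:ℝ)..(edgeLoad path f e), c e s} (V μ)) :
    ConvexOn ℝ (Set.Ioi 0) V ∧
    (∀ μ : ℝ, 0 < μ → DifferentiableAt ℝ V μ) ∧
    (∀ μ : ℝ, 0 < μ → ∀ f lam, IsWardrop path c μ f lam → deriv V μ = lam) ∧
    ContinuousOn (deriv V) (Set.Ioi 0) ∧
    MonotoneOn (deriv V) (Set.Ioi 0) := by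
  have hle : ∀ {ν g}, 0 ≤ ν → Feasible g ν → V ν ≤ beckmannObjective path c g :=
    fun hν hg => (hV _ hν).2 ⟨_, hg, rfl⟩
  have hconv : ConvexOn ℝ (Set.Ioi 0) V := by
    refine ⟨convex_Ioi 0, fun μ hμ ν hν a b ha hb hab => ?_⟩
    obtain ⟨f, hf, hVf⟩ := (hV μ hμ.le).1
    obtain ⟨g, hg, hVg⟩ := (hV ν hν.le).1
    rw [hVf, hVg]
    exact (hle (add_nonneg (mul_nonneg ha hμ.le) (mul_nonneg hb hν.le))
      (hf.smul_add_smul hg ha hb)).trans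
        (beckmannObjective_smul_add_smul_le hc_cont hc_mono f g ha hb hab)
  have hderiv : ∀ {μ f p}, 0 < μ → Feasible f μ → beckmannObjective path c f = V μ → 0 < f p →
      HasDerivAt V (pathCost path c f p) μ := by
    classical
    intro μ f p hμ hf hfV hp
    have hφ : HasDerivAt (fun ν => beckmannObjective path c (f + Pi.single p (ν - μ)))
        (pathCost path c f p) μ := by
      have h := hasDerivAt_beckmannObjective_add_single (path := path) hc_cont f p
      rw [← sub_self μ] at h
      exact h.comp_sub_const μ μ
    refine hconv.hasDerivAt_of_eventually_le (Ioi_mem_nhds hμ) hφ (by simpa using hfV) ?_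
    filter_upwards [lt_mem_nhds hμ, lt_mem_nhds (sub_lt_self μ hp)] with ν hν hνp
    have hfeas : Feasible (f + Pi.single p (ν - μ)) (μ + (ν - μ)) :=
      hf.add_single (by linarith)
    exact hle hν.le (by simpa using hfeas)
  have hdiff : ∀ μ : ℝ, 0 < μ → DifferentiableAt ℝ V μ := fun μ hμ => by
    obtain ⟨f, hf, hVf⟩ := (hV μ hμ.le).1
    obtain ⟨p, hp⟩ := hf.exists_pos hμ
    exact (hderiv hμ hf hVf.symm hp).differentiableAt
  refine ⟨hconv, hdiff, fun μ hμ f lam hf => ?_, hconv.continuousOn_deriv_of_isOpen isOpen_Ioi hdiff,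
    hconv.monotoneOn_deriv hdiff⟩
  obtain ⟨p, hp⟩ := hf.1.exists_pos hμ
  obtain ⟨g, hg, hVg⟩ := (hV μ hμ.le).1
  have hfV : beckmannObjective path c f = V μ :=
    le_antisymm ((hf.beckmannObjective_le hc_cont hc_mono hg).trans_eq hVg.symm) (hle hμ.le hf.1)
  rw [(hderiv hμ hf.1 hfV hp).deriv, hf.2.1 p hp]
end
end

section
/- In any routing game with continuous, nonnegative, nondecreasing edge costs, all Wardrop equilibria at the same demand induce the same edge costs: if f and g are Wardrop equilibria at demand μ > 0, then c_e(x_e(f)) = c_e(x_e(g)) for every edge e ∈ E; in particular, if λ_f and λ_g are equilibrium costs of f and g respectively, then λ_f = λ_g. -/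
open Finset Set

noncomputable section

variable {E P : Type*}

/-- Summing edge costs against edge loads is the same as summing path costs against path flows. -/
theorem sum_cost_mul_edgeLoad [Fintype E] [DecidableEq E] [Fintype P]
    (path : P → Finset E) (c : E → ℝ → ℝ) (f h : P → ℝ) :
    ∑ e, c e (edgeLoad path f e) * edgeLoad path h e = ∑ p, h p * pathCost path c f p := by
  unfold pathCost
  generalize edgeLoad path f = x
  simp only [edgeLoad, Finset.mul_sum, mul_ite, mul_zero]
  rw [Finset.sum_comm]
  refine Finset.sum_congr rfl fun p _ => ?_
  rw [Finset.sum_ite_mem, Finset.univ_inter]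
  exact Finset.sum_congr rfl fun e _ => mul_comm _ _

/-- A Wardrop equilibrium minimizes the total cost at its own, fixed, edge costs. -/
theorem IsWardrop.sum_cost_mul_edgeLoad_le [Fintype E] [DecidableEq E] [Fintype P]
    {path : P → Finset E} {c : E → ℝ → ℝ} {μ lam : ℝ} {f h : P → ℝ}
    (hf : IsWardrop path c μ f lam) (hh : Feasible h μ) :
    ∑ e, c e (edgeLoad path f e) * edgeLoad path f e ≤
      ∑ e, c e (edgeLoad path f e) * edgeLoad path h e := by
  obtain ⟨⟨hf_nonneg, hf_sum⟩, hf_used, hf_min⟩ := hf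
  rw [sum_cost_mul_edgeLoad, sum_cost_mul_edgeLoad]
  calc ∑ p, f p * pathCost path c f p = ∑ p, f p * lam := by
        refine Finset.sum_congr rfl fun p _ => ?_
        rcases (hf_nonneg p).eq_or_lt with hp | hp
        · simp [← hp]
        · rw [hf_used p hp]
    _ = ∑ p, h p * lam := by rw [← Finset.sum_mul, ← Finset.sum_mul, hf_sum, hh.2]
    _ ≤ ∑ p, h p * pathCost path c f p :=
        Finset.sum_le_sum fun p _ => mul_le_mul_of_nonneg_left (hf_min p) (hh.1 p)

/-- If the path costs agree, the equilibrium cost of a nonzero-demand equilibrium `f` is at least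
that of `g`. -/
theorem IsWardrop.le_of_pathCost_eq [DecidableEq E] [Fintype P]
    {path : P → Finset E} {c : E → ℝ → ℝ} {μ lamf lamg : ℝ} {f g : P → ℝ} (hμ : 0 < μ)
    (hf : IsWardrop path c μ f lamf) (hg : IsWardrop path c μ g lamg)
    (hfg : ∀ p, pathCost path c f p = pathCost path c g p) : lamg ≤ lamf := by
  obtain ⟨p, -, hp⟩ : ∃ p ∈ Finset.univ, 0 < f p :=
    Finset.exists_lt_of_sum_lt (by simpa [hf.1.2] using hμ)
  rw [← hf.2.1 p hp, hfg p]
  exact hg.2.2 p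

/-- all Wardrop equilibria at the same demand induce the same edge costs,
and all equilibrium costs coincide. -/
theorem wardrop_edge_costs_unique
    [Fintype E] [DecidableEq E] [Nonempty E] [Fintype P] [Nonempty P]
    (path : P → Finset E) (hpath : ∀ p, (path p).Nonempty)
    (c : E → ℝ → ℝ)
    (hc_cont : ∀ e, Continuous (c e))
    (hc_nonneg : ∀ e x, 0 ≤ c e x)
    (hc_mono : ∀ e, Monotone (c e))
    (μ : ℝ) (hμ : 0 < μ)
    (f g : P → ℝ) (lamf lamg : ℝ)
    (hf : IsWardrop path c μ f lamf) (hg : IsWardrop path c μ g lamg) :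
    (∀ e, c e (edgeLoad path f e) = c e (edgeLoad path g e)) ∧ lamf = lamg := by
  have hterm_nonneg : ∀ e ∈ Finset.univ,
      0 ≤ (c e (edgeLoad path f e) - c e (edgeLoad path g e)) *
        (edgeLoad path f e - edgeLoad path g e) := by
    intro e _
    rcases le_total (edgeLoad path f e) (edgeLoad path g e) with h | h
    · exact mul_nonneg_of_nonpos_of_nonpos (sub_nonpos.2 (hc_mono e h)) (sub_nonpos.2 h)
    · exact mul_nonneg (sub_nonneg.2 (hc_mono e h)) (sub_nonneg.2 h)
  have hsum_nonpos : ∑ e, (c e (edgeLoad path f e) - c e (edgeLoad path g e)) *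
      (edgeLoad path f e - edgeLoad path g e) ≤ 0 := by
    have hvf := hf.sum_cost_mul_edgeLoad_le hg.1
    have hvg := hg.sum_cost_mul_edgeLoad_le hf.1
    simp only [sub_mul, mul_sub, Finset.sum_sub_distrib]
    linarith
  have hterm := (Finset.sum_eq_zero_iff_of_nonneg hterm_nonneg).1
    (le_antisymm hsum_nonpos (Finset.sum_nonneg hterm_nonneg))
  have hcost : ∀ e, c e (edgeLoad path f e) = c e (edgeLoad path g e) := by
    intro e
    rcases mul_eq_zero.1 (hterm e (Finset.mem_univ e)) with h | h
    · exact sub_eq_zero.1 h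
    · rw [sub_eq_zero.1 h]
  have hpathCost : ∀ p, pathCost path c f p = pathCost path c g p := fun p =>
    Finset.sum_congr rfl fun e _ => hcost e
  exact ⟨hcost, le_antisymm (hg.le_of_pathCost_eq hμ hf fun p => (hpathCost p).symm)
    (hf.le_of_pathCost_eq hμ hg hpathCost)⟩
end
end

section
/- In any routing game with continuous, nonnegative, nondecreasing edge costs, the equilibrium edge costs depend continuously on the demand: for every edge e ∈ E, the function μ ↦ τ_e(μ) is continuous on (0,∞); equivalently, if f(μ) is any family assigning to each μ > 0 a Wardrop equilibrium at demand μ, then μ ↦ c_e(x_e(f(μ))) is continuous on (0,∞). -/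
open Finset Set

noncomputable section

variable {E P : Type*}

/-- Total edge cost equals total path cost, for arbitrary edge weights. -/
theorem sum_edgeLoad_mul [Fintype E] [DecidableEq E] [Fintype P] (path : P → Finset E)
    (f : P → ℝ) (w : E → ℝ) :
    ∑ e, edgeLoad path f e * w e = ∑ p, f p * ∑ e ∈ path p, w e := by
  simp only [edgeLoad, Finset.sum_mul, Finset.mul_sum, ite_mul, zero_mul]
  rw [Finset.sum_comm]
  exact Finset.sum_congr rfl fun p _ => by simp [Finset.sum_ite_mem]

theorem Feasible.edgeLoad_le [DecidableEq E] [Fintype P] {f : P → ℝ} {μ : ℝ}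
    (hf : Feasible f μ) (path : P → Finset E) (e : E) : edgeLoad path f e ≤ μ := by
  rw [← hf.2]
  refine Finset.sum_le_sum fun p _ => ?_
  split_ifs
  exacts [le_rfl, hf.1 p]

theorem IsWardrop.sum_mul_pathCost [DecidableEq E] [Fintype P] {path : P → Finset E}
    {c : E → ℝ → ℝ} {μ lam : ℝ} {f : P → ℝ} (hf : IsWardrop path c μ f lam) :
    ∑ p, f p * pathCost path c f p = μ * lam := by
  rw [← hf.1.2, Finset.sum_mul]
  refine Finset.sum_congr rfl fun p _ => ?_
  rcases (hf.1.1 p).eq_or_lt with h | h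
  · simp [← h]
  · rw [hf.2.1 p h]

theorem IsWardrop.mul_le_sum_mul_pathCost [DecidableEq E] [Fintype P] {path : P → Finset E}
    {c : E → ℝ → ℝ} {μ ν lam : ℝ} {f g : P → ℝ} (hf : IsWardrop path c μ f lam)
    (hg : Feasible g ν) : ν * lam ≤ ∑ p, g p * pathCost path c f p := by
  rw [← hg.2, Finset.sum_mul]
  exact Finset.sum_le_sum fun p _ => mul_le_mul_of_nonneg_left (hf.2.2 p) (hg.1 p)

/-- Monotonicity estimate comparing two equilibria at different demands. -/
theorem IsWardrop.sum_sub_mul_sub_le [Fintype E] [DecidableEq E] [Fintype P]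
    {path : P → Finset E} {c : E → ℝ → ℝ} {μ ν lam lam' : ℝ} {f g : P → ℝ}
    (hf : IsWardrop path c μ f lam) (hg : IsWardrop path c ν g lam') :
    ∑ e, (edgeLoad path f e - edgeLoad path g e) *
      (c e (edgeLoad path f e) - c e (edgeLoad path g e)) ≤ (μ - ν) * (lam - lam') := by
  have hff := hf.sum_mul_pathCost
  have hgg := hg.sum_mul_pathCost
  have hfg := hf.mul_le_sum_mul_pathCost hg.1
  have hgf := hg.mul_le_sum_mul_pathCost hf.1
  simp only [pathCost, ← sum_edgeLoad_mul] at hff hgg hfg hgf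
  simp only [mul_sub, sub_mul, Finset.sum_sub_distrib]
  linarith

theorem IsWardrop.nonneg [DecidableEq E] [Fintype P] {path : P → Finset E}
    {c : E → ℝ → ℝ} (hc_nonneg : ∀ e x, 0 ≤ c e x) {μ lam : ℝ} {f : P → ℝ} (hμ : 0 < μ)
    (hf : IsWardrop path c μ f lam) : 0 ≤ lam := by
  have hsum : 0 ≤ μ * lam := hf.sum_mul_pathCost ▸ Finset.sum_nonneg fun p _ =>
    mul_nonneg (hf.1.1 p) (Finset.sum_nonneg fun e _ => hc_nonneg e _)
  exact nonneg_of_mul_nonneg_right hsum hμ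

theorem IsWardrop.le_sum_cost [DecidableEq E] [Fintype P] {path : P → Finset E}
    {c : E → ℝ → ℝ} (hc_mono : ∀ e, Monotone (c e)) {μ M lam : ℝ} {f : P → ℝ} (hM : μ ≤ M)
    (hf : IsWardrop path c μ f lam) (p : P) : lam ≤ ∑ e ∈ path p, c e M :=
  (hf.2.2 p).trans <| Finset.sum_le_sum fun e _ =>
    hc_mono e ((hf.1.edgeLoad_le path e).trans hM)

/-- the equilibrium edge costs depend continuously on the demand: for any
family of Wardrop equilibria `feq μ` (one for each demand `μ > 0`), the map
`μ ↦ c_e(x_e(feq μ))` is continuous on `(0,∞)` for every edge `e`. -/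
theorem equilibrium_edge_costs_continuous
    [Fintype E] [DecidableEq E] [Nonempty E] [Fintype P] [Nonempty P]
    (path : P → Finset E) (hpath : ∀ p, (path p).Nonempty)
    (c : E → ℝ → ℝ)
    (hc_cont : ∀ e, Continuous (c e))
    (hc_nonneg : ∀ e x, 0 ≤ c e x)
    (hc_mono : ∀ e, Monotone (c e))
    (feq : ℝ → P → ℝ) (lamf : ℝ → ℝ)
    (hfeq : ∀ μ : ℝ, 0 < μ → IsWardrop path c μ (feq μ) (lamf μ)) :
    ∀ e, ContinuousOn (fun μ => c e (edgeLoad path (feq μ) e)) (Set.Ioi 0) := by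
  intro e
  rw [Metric.continuousOn_iff]
  intro ν hν ε hε
  rw [Set.mem_Ioi] at hν
  obtain ⟨δ, hδ, hcδ⟩ := Metric.continuousAt_iff.1
    ((hc_cont e).continuousAt (x := edgeLoad path (feq ν) e)) ε hε
  obtain ⟨p⟩ := ‹Nonempty P›
  set B := ∑ e ∈ path p, c e (ν + 1)
  have hB : 0 ≤ B := Finset.sum_nonneg fun e _ => hc_nonneg e _
  refine ⟨min 1 (δ * ε / (B + 1)), by positivity, fun μ hμ hdist => ?_⟩
  rw [Set.mem_Ioi] at hμ
  rw [Real.dist_eq, lt_min_iff, lt_div_iff₀ (by positivity)] at hdist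
  obtain ⟨hdist_one, hdist_small⟩ := hdist
  have hfμ := hfeq μ hμ
  have hfν := hfeq ν hν
  have hlam : |lamf μ - lamf ν| ≤ B := by
    have hμ_le := hfμ.le_sum_cost hc_mono (M := ν + 1) (by linarith [(abs_lt.1 hdist_one).2]) p
    have hν_le := hfν.le_sum_cost hc_mono (M := ν + 1) (by linarith) p
    have hμ_nonneg := hfμ.nonneg hc_nonneg hμ
    have hν_nonneg := hfν.nonneg hc_nonneg hν
    exact abs_le.2 ⟨by linarith, by linarith⟩
  have hterm_nonneg : ∀ e, 0 ≤ (edgeLoad path (feq μ) e - edgeLoad path (feq ν) e) *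
      (c e (edgeLoad path (feq μ) e) - c e (edgeLoad path (feq ν) e)) := fun e => by
    rcases le_total (edgeLoad path (feq μ) e) (edgeLoad path (feq ν) e) with h | h
    · exact mul_nonneg_of_nonpos_of_nonpos (sub_nonpos.2 h) (sub_nonpos.2 (hc_mono e h))
    · exact mul_nonneg (sub_nonneg.2 h) (sub_nonneg.2 (hc_mono e h))
  have hterm := (Finset.single_le_sum (fun e _ => hterm_nonneg e) (Finset.mem_univ e)).trans
    (hfμ.sum_sub_mul_sub_le hfν)
  by_contra! hfar
  have hload := mt (fun h => hcδ h) hfar.not_gt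
  rw [not_lt, Real.dist_eq] at hload
  rw [Real.dist_eq] at hfar
  have hlower := mul_le_mul hload hfar hε.le (abs_nonneg _)
  rw [← abs_mul, abs_of_nonneg (hterm_nonneg e)] at hlower
  have hupper : (μ - ν) * (lamf μ - lamf ν) ≤ |μ - ν| * (B + 1) :=
    (le_abs_self _).trans <| (abs_mul _ _).trans_le <|
      mul_le_mul_of_nonneg_left (by linarith) (abs_nonneg _)
  linarith
end
end

section
/- In a single origin–destination network in which every edge cost c_e is C¹, nonnegative, with strictly positive derivative, with t ↦ t·c_e(t) convex on [0,∞), and such that V*(μ) > 0 for all μ > 0, the price of anarchy PoA is continuously differentiable at every regular demand μ₀ > 0. -/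
open Finset Set

noncomputable section

variable {V E : Type*}

/-- `es` is a nonempty walk of consecutive edges from vertex `a` to vertex `b`. -/
def IsWalkFrom (src tgt : E → V) (a b : V) (es : List E) : Prop :=
  es ≠ [] ∧ es.Chain' (fun e e' => tgt e = src e') ∧
    es.head?.map src = some a ∧ es.getLast?.map tgt = some b

/-- `es` is a simple directed path from `a` to `b` (no repeated vertices). -/
def IsSimplePathFrom (src tgt : E → V) (a b : V) (es : List E) : Prop :=
  IsWalkFrom src tgt a b es ∧ (es.map src ++ [b]).Nodup

/-- Load induced on edge `e` by the path-flow `f` over the path collection `P`. -/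
def gLoad [DecidableEq E] (P : Finset (List E)) (f : List E → ℝ) (e : E) : ℝ :=
  ∑ p ∈ P, if e ∈ p then f p else 0

/-- Feasibility of a flow for demand `μ`. -/
def gFeasible (P : Finset (List E)) (f : List E → ℝ) (μ : ℝ) : Prop :=
  (∀ p ∈ P, 0 ≤ f p) ∧ ∑ p ∈ P, f p = μ

/-- Cost of path `p` under flow `f`. -/
def gPathCost [DecidableEq E] (P : Finset (List E)) (c : E → ℝ → ℝ)
    (f : List E → ℝ) (p : List E) : ℝ :=
  (p.map fun e => c e (gLoad P f e)).sum

/-- Wardrop equilibrium with equilibrium cost `lam` at demand `μ`. -/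
def gIsWardrop [DecidableEq E] (P : Finset (List E)) (c : E → ℝ → ℝ)
    (μ : ℝ) (f : List E → ℝ) (lam : ℝ) : Prop :=
  gFeasible P f μ ∧ (∀ p ∈ P, 0 < f p → gPathCost P c f p = lam) ∧
    ∀ p ∈ P, lam ≤ gPathCost P c f p

/-- The active network: edges lying on some `O`-`D` path of minimal cost `lam`. -/
def gActive [DecidableEq E] (P : Finset (List E)) (c : E → ℝ → ℝ)
    (f : List E → ℝ) (lam : ℝ) : Set E :=
  {e | ∃ p ∈ P, gPathCost P c f p = lam ∧ e ∈ p}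

/-- A regular demand: some Wardrop equilibrium puts positive load on each active edge. -/
def gRegular [DecidableEq E] (P : Finset (List E)) (c : E → ℝ → ℝ) (μ : ℝ) : Prop :=
  ∃ f lam, gIsWardrop P c μ f lam ∧ ∀ e ∈ gActive P c f lam, 0 < gLoad P f e

/-- `T_v`: minimal cost of a directed (simple) path from `O` to `v` under flow `f`. -/
def Tpot [DecidableEq E] (src tgt : E → V) (O : V) (P : Finset (List E))
    (c : E → ℝ → ℝ) (f : List E → ℝ) (v : V) : ℝ :=
  sInf {y | ∃ es, IsSimplePathFrom src tgt O v es ∧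
    y = (es.map fun e => c e (gLoad P f e)).sum}

/-- Social cost of a flow. -/
def gSocialCost [Fintype E] [DecidableEq E] (P : Finset (List E)) (c : E → ℝ → ℝ)
    (f : List E → ℝ) : ℝ :=
  ∑ e, gLoad P f e * c e (gLoad P f e)

section Walks

/-- `es` is a possibly empty walk of consecutive edges from `a` to `b`. -/
def IsWalk (src tgt : E → V) : V → V → List E → Prop
  | a, b, [] => a = b
  | a, b, e :: es => src e = a ∧ IsWalk src tgt (tgt e) b es

variable {src tgt : E → V} {a b v : V} {es es' : List E}

theorem isWalk_append :
    IsWalk src tgt a b (es ++ es') ↔ ∃ v, IsWalk src tgt a v es ∧ IsWalk src tgt v b es' := by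
  induction es generalizing a with
  | nil => simp [IsWalk]
  | cons e es ih => simp [IsWalk, ih, and_assoc]

theorem IsWalk.append (h : IsWalk src tgt a v es) (h' : IsWalk src tgt v b es') :
    IsWalk src tgt a b (es ++ es') :=
  isWalk_append.2 ⟨v, h, h'⟩

theorem IsWalk.end_unique {b' : V} (h : IsWalk src tgt a b es) (h' : IsWalk src tgt a b' es) :
    b = b' := by
  induction es generalizing a with
  | nil => exact Eq.trans (Eq.symm h) h'
  | cons e es ih => exact ih h.2 h'.2

theorem isWalkFrom_iff : IsWalkFrom src tgt a b es ↔ es ≠ [] ∧ IsWalk src tgt a b es := by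
  unfold IsWalkFrom List.Chain'
  induction es generalizing a with
  | nil => simp
  | cons e es ih =>
    cases es with
    | nil => simp [IsWalk]
    | cons e' es =>
      have := @ih (tgt e)
      simp only [ne_eq, reduceCtorEq, not_false_eq_true, true_and, List.head?_cons,
        Option.map_some, Option.some.injEq, List.isChain_cons_cons, List.getLast?_cons_cons,
        IsWalk] at this ⊢
      rw [← this]
      constructor
      · rintro ⟨⟨h1, h2⟩, h3, h4⟩
        exact ⟨h3, h2, h1.symm, h4⟩
      · rintro ⟨h3, h2, h1, h4⟩
        exact ⟨⟨h1.symm, h2⟩, h3, h4⟩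

theorem isSimplePathFrom_iff (hab : a ≠ b) :
    IsSimplePathFrom src tgt a b es ↔ IsWalk src tgt a b es ∧ (es.map src ++ [b]).Nodup := by
  unfold IsSimplePathFrom
  rw [isWalkFrom_iff]
  refine and_congr_left fun _ => and_iff_right_of_imp ?_
  rintro h rfl
  exact hab h

theorem IsWalk.exists_suffix (h : IsWalk src tgt a b es) (hv : v ∈ es.map src ++ [b]) :
    ∃ l r, es = l ++ r ∧ IsWalk src tgt v b r := by
  induction es generalizing a with
  | nil =>
    simp only [List.map_nil, List.nil_append, List.mem_singleton] at hv
    exact ⟨[], [], rfl, hv⟩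
  | cons e es ih =>
    by_cases hve : v = src e
    · exact ⟨[], e :: es, rfl, hve.symm, h.2⟩
    · obtain ⟨l, r, rfl, hr⟩ := ih h.2 (by simpa [hve] using hv)
      exact ⟨e :: l, r, rfl, hr⟩

/-- With positive edge weights, a walk that revisits a vertex is strictly heavier than some simple
walk with the same endpoints. -/
theorem IsWalk.nodup_or_exists_lt {w : E → ℝ} (hw : ∀ e, 0 < w e) (h : IsWalk src tgt a b es) :
    (es.map src ++ [b]).Nodup ∨ ∃ es', IsWalk src tgt a b es' ∧ (es'.map src ++ [b]).Nodup ∧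
      (es'.map w).sum < (es.map w).sum := by
  induction es generalizing a with
  | nil => simp
  | cons e es ih =>
    obtain ⟨r, hr, hnd, hle⟩ : ∃ r, IsWalk src tgt (tgt e) b r ∧ (r.map src ++ [b]).Nodup ∧
        (r = es ∨ (r.map w).sum < (es.map w).sum) := by
      rcases ih h.2 with hs | ⟨r, hr, hnd, hlt⟩
      · exact ⟨es, h.2, hs, Or.inl rfl⟩
      · exact ⟨r, hr, hnd, Or.inr hlt⟩
    by_cases hmem : src e ∈ r.map src ++ [b]
    · obtain ⟨l, t, rfl, ht⟩ := hr.exists_suffix hmem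
      right
      refine ⟨t, h.1 ▸ ht, ?_, ?_⟩
      · rw [List.map_append, List.append_assoc] at hnd
        exact hnd.of_append_right
      · have hl : 0 ≤ (l.map w).sum := by
          apply List.sum_nonneg
          simp only [List.mem_map]
          rintro _ ⟨x, _, rfl⟩
          exact (hw x).le
        have h1 := hw e
        have h2 : ((l ++ t).map w).sum ≤ (es.map w).sum := by
          rcases hle with rfl | hlt
          exacts [le_rfl, hlt.le]
        simp only [List.map_append, List.sum_append] at h2
        simp only [List.map_cons, List.sum_cons]
        linarith
    · have hnd' : ((e :: r).map src ++ [b]).Nodup := by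
        rw [List.map_cons, List.cons_append]
        exact List.nodup_cons.2 ⟨hmem, hnd⟩
      rcases hle with rfl | hlt
      · exact Or.inl hnd'
      · refine Or.inr ⟨e :: r, ⟨h.1, hr⟩, hnd', ?_⟩
        simpa using hlt

theorem IsSimplePathFrom.nodup (h : IsSimplePathFrom src tgt a b es) : es.Nodup :=
  (h.2.of_append_left).of_map

end Walks

theorem gFeasible.convex_comb {P : Finset (List E)} {f g : List E → ℝ} {μ μ' s t : ℝ}
    (hf : gFeasible P f μ) (hg : gFeasible P g μ') (hs : 0 ≤ s) (ht : 0 ≤ t) :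
    gFeasible P (fun p => s * f p + t * g p) (s * μ + t * μ') := by
  refine ⟨fun p hp => ?_, ?_⟩
  · have := hf.1 p hp
    have := hg.1 p hp
    positivity
  · rw [Finset.sum_add_distrib, ← Finset.mul_sum, ← Finset.mul_sum, hf.2, hg.2]

section Flows

variable [DecidableEq E] {P : Finset (List E)} {c : E → ℝ → ℝ} {f g : List E → ℝ} {μ lam : ℝ}

theorem sum_map_eq_sum_count [Fintype E] (w : E → ℝ) (p : List E) :
    (p.map w).sum = ∑ e, (p.count e : ℝ) * w e := by
  rw [Finset.sum_list_map_count]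
  simp only [nsmul_eq_mul]
  refine Finset.sum_subset (Finset.subset_univ _) fun e _ he => ?_
  rw [List.count_eq_zero_of_not_mem (by simpa using he)]
  simp

theorem gLoad_eq_sum_count (hnd : ∀ p ∈ P, p.Nodup) (f : List E → ℝ) (e : E) :
    gLoad P f e = ∑ p ∈ P, f p * (p.count e : ℝ) := by
  refine Finset.sum_congr rfl fun p hp => ?_
  rw [(hnd p hp).count]
  split_ifs <;> simp

theorem gLoad_nonneg (h : ∀ p ∈ P, 0 ≤ f p) (e : E) : 0 ≤ gLoad P f e := by
  refine Finset.sum_nonneg fun p hp => ?_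
  split_ifs
  exacts [h p hp, le_rfl]

theorem gLoad_linear_comb (s t : ℝ) (f g : List E → ℝ) (e : E) :
    gLoad P (fun p => s * f p + t * g p) e = s * gLoad P f e + t * gLoad P g e := by
  simp only [gLoad, Finset.mul_sum, ← Finset.sum_add_distrib]
  refine Finset.sum_congr rfl fun p _ => ?_
  split_ifs <;> simp

theorem gPathCost_congr (h : gLoad P f = gLoad P g) (p : List E) :
    gPathCost P c f p = gPathCost P c g p := by
  simp only [gPathCost, h]

theorem sum_mul_pathWeight [Fintype E] (hnd : ∀ p ∈ P, p.Nodup) (w : E → ℝ) (f : List E → ℝ) :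
    ∑ p ∈ P, f p * (p.map w).sum = ∑ e, gLoad P f e * w e := by
  simp only [sum_map_eq_sum_count, gLoad_eq_sum_count hnd, Finset.mul_sum, Finset.sum_mul]
  rw [Finset.sum_comm]
  simp only [mul_assoc]

theorem gIsWardrop.exists_used (h : gIsWardrop P c μ f lam) (hμ : 0 < μ) : ∃ p ∈ P, 0 < f p := by
  by_contra! hcon
  have := Finset.sum_nonpos hcon
  rw [h.1.2] at this
  linarith

theorem gIsWardrop.sum_mul_pathCost (h : gIsWardrop P c μ f lam) :
    ∑ p ∈ P, f p * gPathCost P c f p = μ * lam := by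
  rw [← h.1.2, Finset.sum_mul]
  refine Finset.sum_congr rfl fun p hp => ?_
  rcases (h.1.1 p hp).eq_or_lt with h0 | h0
  · simp [← h0]
  · rw [h.2.1 p hp h0]

theorem gIsWardrop.le_sum_mul_pathCost (h : gIsWardrop P c μ f lam) (hg : gFeasible P g μ) :
    μ * lam ≤ ∑ p ∈ P, g p * gPathCost P c f p := by
  rw [← hg.2, Finset.sum_mul]
  exact Finset.sum_le_sum fun p hp => mul_le_mul_of_nonneg_left (h.2.2 p hp) (hg.1 p hp)

theorem gIsWardrop.load_unique [Fintype E] (hnd : ∀ p ∈ P, p.Nodup)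
    (hc : ∀ e, StrictMono (c e)) {lam' : ℝ}
    (hf : gIsWardrop P c μ f lam) (hg : gIsWardrop P c μ g lam') : gLoad P f = gLoad P g := by
  have h1 := hf.sum_mul_pathCost
  have h2 := hg.sum_mul_pathCost
  have h3 := hf.le_sum_mul_pathCost hg.1
  have h4 := hg.le_sum_mul_pathCost hf.1
  simp only [gPathCost, sum_mul_pathWeight hnd] at h1 h2 h3 h4
  have hterm : ∀ e ∈ Finset.univ, 0 ≤ (gLoad P f e - gLoad P g e) *
      (c e (gLoad P f e) - c e (gLoad P g e)) := fun e _ => by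
    rcases le_total (gLoad P f e) (gLoad P g e) with h | h
    · exact mul_nonneg_of_nonpos_of_nonpos (sub_nonpos.2 h)
        (sub_nonpos.2 ((hc e).monotone h))
    · exact mul_nonneg (sub_nonneg.2 h) (sub_nonneg.2 ((hc e).monotone h))
  have hsum : ∑ e, (gLoad P f e - gLoad P g e) *
      (c e (gLoad P f e) - c e (gLoad P g e)) = 0 := by
    refine le_antisymm ?_ (Finset.sum_nonneg hterm)
    simp only [sub_mul, mul_sub, Finset.sum_sub_distrib]
    linarith
  funext e
  rcases mul_eq_zero.1 ((Finset.sum_eq_zero_iff_of_nonneg hterm).1 hsum e (Finset.mem_univ e))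
    with h | h
  · exact sub_eq_zero.1 h
  · exact (hc e).injective (sub_eq_zero.1 h)

theorem gIsWardrop.cost_unique [Fintype E] (hnd : ∀ p ∈ P, p.Nodup)
    (hc : ∀ e, StrictMono (c e)) (hμ : 0 < μ) {lam' : ℝ}
    (hf : gIsWardrop P c μ f lam) (hg : gIsWardrop P c μ g lam') : lam = lam' := by
  have hload := hf.load_unique hnd hc hg
  obtain ⟨p, hp, hfp⟩ := hf.exists_used hμ
  obtain ⟨q, hq, hgq⟩ := hg.exists_used hμ
  apply le_antisymm
  · rw [← hg.2.1 q hq hgq, ← gPathCost_congr hload]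
    exact hf.2.2 q hq
  · rw [← hf.2.1 p hp hfp, gPathCost_congr hload]
    exact hg.2.2 p hp

/-- The midpoint of two equilibria with the same loads is an equilibrium with these loads. -/
theorem gIsWardrop.midpoint (hf : gIsWardrop P c μ f lam) (hg : gIsWardrop P c μ g lam)
    (hload : gLoad P g = gLoad P f) :
    ∃ h, gIsWardrop P c μ h lam ∧ gLoad P h = gLoad P f ∧
      ∀ p ∈ P, 0 < f p ∨ 0 < g p → 0 < h p := by
  have hl : gLoad P (fun p => 1 / 2 * f p + 1 / 2 * g p) = gLoad P f := by
    funext e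
    rw [gLoad_linear_comb, hload]
    ring
  refine ⟨_, ⟨?_, fun p hp hpos => ?_, fun p hp => ?_⟩, hl, fun p hp hpos => ?_⟩
  · convert hf.1.convex_comb hg.1 (s := 1 / 2) (t := 1 / 2) (by norm_num) (by norm_num) using 1
    ring
  · rw [gPathCost_congr hl]
    rcases (hf.1.1 p hp).eq_or_lt with h0 | h0
    · rw [← gPathCost_congr hload]
      refine hg.2.1 p hp ?_
      simp only [← h0] at hpos
      linarith
    · exact hf.2.1 p hp h0
  · rw [gPathCost_congr hl]
    exact hf.2.2 p hp
  · have h1 := hf.1.1 p hp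
    have h2 := hg.1.1 p hp
    rcases hpos with h | h <;> linarith

end Flows

section FullSupport

variable [DecidableEq E] {src tgt : E → V} {O D : V} {P : Finset (List E)} {c : E → ℝ → ℝ}
  {f : List E → ℝ} {μ lam : ℝ}

theorem gIsWardrop.le_walkCost (hOD : O ≠ D) (hP : ∀ es, es ∈ P ↔ IsSimplePathFrom src tgt O D es)
    (hc : ∀ e x, 0 < c e x) (h : gIsWardrop P c μ f lam) {es : List E}
    (hes : IsWalk src tgt O D es) :
    lam ≤ gPathCost P c f es ∧ (gPathCost P c f es = lam → es ∈ P) := by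
  simp only [isSimplePathFrom_iff hOD] at hP
  rcases hes.nodup_or_exists_lt (w := fun e => c e (gLoad P f e)) fun e => hc e _ with
    hs | ⟨r, hr, hnd, hlt⟩
  · have hmem := (hP es).2 ⟨hes, hs⟩
    exact ⟨h.2.2 es hmem, fun _ => hmem⟩
  · have hle : lam ≤ gPathCost P c f r := h.2.2 r ((hP r).2 ⟨hr, hnd⟩)
    have hlam : lam < gPathCost P c f es := hle.trans_lt hlt
    exact ⟨hlam.le, fun heq => absurd heq (ne_of_gt hlam)⟩

/-- If two used paths cross at a vertex, then swapping their tails produces an equilibrium with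
the same loads which uses a path obtained by the swap. -/
theorem gIsWardrop.exchange (hOD : O ≠ D) (hP : ∀ es, es ∈ P ↔ IsSimplePathFrom src tgt O D es)
    (hc : ∀ e x, 0 < c e x) (h : gIsWardrop P c μ f lam) {v : V} {u s a t : List E}
    (hu : IsWalk src tgt O v u) (hs : IsWalk src tgt v D s)
    (ha : IsWalk src tgt O v a) (ht : IsWalk src tgt v D t)
    (hus : u ++ s ∈ P) (hat : a ++ t ∈ P) (hfus : 0 < f (u ++ s)) (hfat : 0 < f (a ++ t)) :
    u ++ t ∈ P ∧ ∃ g, gIsWardrop P c μ g lam ∧ gLoad P g = gLoad P f ∧ 0 < g (u ++ t) := by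
  have hnd : ∀ p ∈ P, p.Nodup := fun p hp => ((hP p).1 hp).nodup
  have h1 := h.le_walkCost hOD hP hc (hu.append ht)
  have h2 := h.le_walkCost hOD hP hc (ha.append hs)
  have h3 := h.2.1 _ hus hfus
  have h4 := h.2.1 _ hat hfat
  have hcost : gPathCost P c f (u ++ t) = lam ∧ gPathCost P c f (a ++ s) = lam := by
    simp only [gPathCost, List.map_append, List.sum_append] at h1 h2 h3 h4 ⊢
    constructor <;> linarith [h1.1, h2.1]
  have hut := h1.2 hcost.1
  have has := h2.2 hcost.2
  obtain ⟨δ, hδ, hδ1, hδ2⟩ : ∃ δ : ℝ, 0 < δ ∧ 2 * δ ≤ f (u ++ s) ∧ 2 * δ ≤ f (a ++ t) :=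
    ⟨min (f (u ++ s)) (f (a ++ t)) / 2, by positivity, by
      linarith [min_le_left (f (u ++ s)) (f (a ++ t))], by
      linarith [min_le_right (f (u ++ s)) (f (a ++ t))]⟩
  let ind (q p : List E) : ℝ := if p = q then δ else 0
  have hind : ∀ q p, 0 ≤ ind q p := fun q p => by
    simp only [ind]
    split_ifs
    exacts [hδ.le, le_rfl]
  have hsub : ∀ p ∈ P, 0 ≤ f p - ind (u ++ s) p - ind (a ++ t) p := fun p hp => by
    have := h.1.1 p hp
    simp only [ind]
    split_ifs with e1 e2 e2
    · rw [e1]; linarith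
    · rw [e1]; linarith
    · rw [e2]; linarith
    · linarith
  let g : List E → ℝ := fun p =>
    f p - ind (u ++ s) p - ind (a ++ t) p + ind (u ++ t) p + ind (a ++ s) p
  have hload : gLoad P g = gLoad P f := by
    funext e
    have hsum : ∀ q ∈ P, ∑ p ∈ P, ind q p * (p.count e : ℝ) = δ * q.count e := fun q hq => by
      simp [ind, ite_mul, Finset.sum_ite_eq', hq]
    rw [gLoad_eq_sum_count hnd, gLoad_eq_sum_count hnd]
    simp only [g, add_mul, sub_mul, Finset.sum_add_distrib, Finset.sum_sub_distrib]
    rw [hsum _ hus, hsum _ hat, hsum _ hut, hsum _ has]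
    simp only [List.count_append, Nat.cast_add]
    ring
  have htotal : ∑ p ∈ P, g p = μ := by
    have hsum : ∀ q ∈ P, ∑ p ∈ P, ind q p = δ := fun q hq => by
      simp [ind, Finset.sum_ite_eq', hq]
    simp only [g, Finset.sum_add_distrib, Finset.sum_sub_distrib]
    rw [hsum _ hus, hsum _ hat, hsum _ hut, hsum _ has, h.1.2]
    ring
  refine ⟨hut, g, ⟨⟨fun p hp => ?_, htotal⟩, fun p hp hgp => ?_, fun p hp => ?_⟩, hload, ?_⟩
  · have := hsub p hp
    have := hind (u ++ t) p
    have := hind (a ++ s) p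
    simp only [g]
    linarith
  · rw [gPathCost_congr hload]
    by_cases hp1 : p = u ++ t
    · rw [hp1, hcost.1]
    by_cases hp2 : p = a ++ s
    · rw [hp2, hcost.2]
    refine h.2.1 p hp ?_
    have := hind (u ++ s) p
    have := hind (a ++ t) p
    simp only [g, show ind (u ++ t) p = 0 from if_neg hp1,
      show ind (a ++ s) p = 0 from if_neg hp2] at hgp
    linarith
  · rw [gPathCost_congr hload]
    exact h.2.2 p hp
  · have := hsub _ hut
    have := hind (a ++ s) (u ++ t)
    simp only [g, show ind (u ++ t) (u ++ t) = δ from if_pos rfl]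
    linarith

/-- If every active edge is loaded, then each path of minimal cost is used by some equilibrium
with the same loads. -/
theorem gIsWardrop.exists_using_path (hOD : O ≠ D)
    (hP : ∀ es, es ∈ P ↔ IsSimplePathFrom src tgt O D es)
    (hc : ∀ e x, 0 < c e x) (hμ : 0 < μ) (h : gIsWardrop P c μ f lam)
    (hact : ∀ e ∈ gActive P c f lam, 0 < gLoad P f e) {p : List E} (hp : p ∈ P)
    (hpc : gPathCost P c f p = lam) :
    ∃ g, gIsWardrop P c μ g lam ∧ gLoad P g = gLoad P f ∧ 0 < g p := by
  have hwalk : ∀ q ∈ P, IsWalk src tgt O D q := fun q hq =>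
    ((isSimplePathFrom_iff hOD).1 ((hP q).1 hq)).1
  have key : ∀ u w, p = u ++ w → ∃ s g, gIsWardrop P c μ g lam ∧ gLoad P g = gLoad P f ∧
      u ++ s ∈ P ∧ 0 < g (u ++ s) := by
    intro u
    induction u using List.reverseRecOn with
    | nil =>
      intro w _
      obtain ⟨q, hq, hfq⟩ := h.exists_used hμ
      exact ⟨q, f, h, rfl, hq, hfq⟩
    | append_singleton u e ih =>
      intro w hw
      rw [List.append_assoc] at hw
      obtain ⟨s, g, hg, hgl, hus, hgus⟩ := ih _ hw
      have hload := hact e ⟨p, hp, hpc, by simp [hw]⟩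
      obtain ⟨q, hq, hfq, heq⟩ : ∃ q ∈ P, 0 < f q ∧ e ∈ q := by
        by_contra! hcon
        refine hload.not_ge (Finset.sum_nonpos fun q hq => ?_)
        split_ifs with he
        · by_contra! hlt
          exact hcon q hq hlt he
        · exact le_rfl
      obtain ⟨a, b, rfl⟩ := List.append_of_mem heq
      obtain ⟨k, hk, hkl, hkpos⟩ := h.midpoint hg hgl
      obtain ⟨v, hu, hv⟩ := isWalk_append.1 (hw ▸ hwalk p hp)
      obtain ⟨v', hu', hs⟩ := isWalk_append.1 (hwalk _ hus)
      obtain ⟨v'', ha, hb⟩ := isWalk_append.1 (hwalk _ hq)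
      obtain rfl := hu.end_unique hu'
      obtain rfl : v = v'' := hv.1.symm.trans hb.1
      obtain ⟨hmem, m, hm, hml, hmpos⟩ := hk.exchange hOD hP hc hu hs ha hb hus hq
        (hkpos _ hus (Or.inr hgus)) (hkpos _ hq (Or.inl hfq))
      exact ⟨b, m, hm, hml.trans hkl, by simpa using hmem, by simpa using hmpos⟩
  obtain ⟨s, g, hg, hgl, hmem, hpos⟩ := key p [] (by simp)
  cases s with
  | nil => exact ⟨g, hg, hgl, by simpa using hpos⟩
  | cons e s =>
    obtain ⟨v, hv, he⟩ := isWalk_append.1 (hwalk _ hmem)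
    obtain rfl := hv.end_unique (hwalk p hp)
    have hnd := ((isSimplePathFrom_iff hOD).1 ((hP _).1 hmem)).2
    exact absurd rfl ((List.nodup_append.1 hnd).2.2 v (by simp [he.1]) v (by simp))

/-- At a regular demand some equilibrium uses all paths of minimal cost. -/
theorem gIsWardrop.exists_full_support (hOD : O ≠ D)
    (hP : ∀ es, es ∈ P ↔ IsSimplePathFrom src tgt O D es)
    (hc : ∀ e x, 0 < c e x) (hμ : 0 < μ) (h : gIsWardrop P c μ f lam)
    (hact : ∀ e ∈ gActive P c f lam, 0 < gLoad P f e) :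
    ∃ g, gIsWardrop P c μ g lam ∧ ∀ p ∈ P, gPathCost P c g p = lam → 0 < g p := by
  suffices key : ∀ S ⊆ P, ∃ g, gIsWardrop P c μ g lam ∧ gLoad P g = gLoad P f ∧
      ∀ p ∈ S, gPathCost P c f p = lam → 0 < g p by
    obtain ⟨g, hg, hgl, hpos⟩ := key P subset_rfl
    exact ⟨g, hg, fun p hp hpc => hpos p hp (by rwa [← gPathCost_congr hgl])⟩
  intro S
  induction S using Finset.induction_on with
  | empty => exact fun _ => ⟨f, h, rfl, by simp⟩
  | insert p S _ ih =>
    intro hS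
    have hpP := hS (Finset.mem_insert_self p S)
    obtain ⟨g, hg, hgl, hpos⟩ := ih ((Finset.subset_insert p S).trans hS)
    by_cases hpc : gPathCost P c f p = lam
    · obtain ⟨k, hk, hkl, hkpos⟩ := h.exists_using_path hOD hP hc hμ hact hpP hpc
      obtain ⟨m, hm, hml, hmpos⟩ := hg.midpoint hk (hkl.trans hgl.symm)
      refine ⟨m, hm, hml.trans hgl, fun q hq hqc => hmpos q (hS hq) ?_⟩
      rcases Finset.mem_insert.1 hq with rfl | hq
      · exact Or.inr hkpos
      · exact Or.inl (hpos q hq hqc)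
    · refine ⟨g, hg, hgl, fun q hq hqc => ?_⟩
      rcases Finset.mem_insert.1 hq with rfl | hq
      · exact absurd hqc hpc
      · exact hpos q hq hqc

end FullSupport

section OptimalValue

/-- A convex function which is touched from above by a differentiable function is
differentiable at the touching point. -/
theorem ConvexOn.hasDerivAt_of_eventually_le_s9 {S : Set ℝ} {F G : ℝ → ℝ} {x m : ℝ}
    (hF : ConvexOn ℝ S F) (hS : S ∈ nhds x) (hG : HasDerivAt G m x)
    (hle : ∀ᶠ y in nhds x, F y ≤ G y) (heq : F x = G x) : HasDerivAt F m x := by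
  have hrefl : Filter.Tendsto (fun y => 2 * x - y) (nhds x) (nhds x) := by
    have : ContinuousAt (fun y : ℝ => 2 * x - y) x := by fun_prop
    simpa [ContinuousAt, two_mul] using this
  have hG' : HasDerivAt (fun y => 2 * F x - G (2 * x - y)) m x := by
    have hG1 : HasDerivAt G m (2 * x - x) := by simpa [two_mul] using hG
    have := (hG1.comp x ((hasDerivAt_id x).const_sub (2 * x))).const_sub (2 * F x)
    simpa using this
  rw [hasDerivAt_iff_isLittleO] at hG hG' ⊢
  refine Asymptotics.IsBigO.trans_isLittleO ?_ (hG.norm_left.add hG'.norm_left)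
  refine Asymptotics.IsBigO.of_bound 1 ?_
  filter_upwards [hle, hrefl.eventually hle, hS, hrefl.eventually hS] with y h1 h2 h3 h4
  have hconv := hF.2 h3 h4 (by norm_num : (0 : ℝ) ≤ 1 / 2) (by norm_num : (0 : ℝ) ≤ 1 / 2)
    (by norm_num)
  have hmid : (1 / 2 : ℝ) • y + (1 / 2 : ℝ) • (2 * x - y) = x := by simp only [smul_eq_mul]; ring
  rw [hmid] at hconv
  simp only [smul_eq_mul] at hconv ⊢
  have hx : 2 * x - x = x := by ring
  rw [hx, heq, one_mul, Real.norm_eq_abs, Real.norm_eq_abs, Real.norm_eq_abs, Real.norm_eq_abs]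
  rw [heq] at hconv
  refine le_trans ?_ (le_abs_self _)
  rw [abs_le]
  constructor
  · have := neg_abs_le (2 * G x - G (2 * x - y) - (2 * G x - G x) - (y - x) * m)
    have := abs_nonneg (G y - G x - (y - x) * m)
    linarith
  · have := le_abs_self (G y - G x - (y - x) * m)
    have := abs_nonneg (2 * G x - G (2 * x - y) - (2 * G x - G x) - (y - x) * m)
    linarith

theorem ConvexOn.continuousOn_deriv {S : Set ℝ} (hS : IsOpen S) {F : ℝ → ℝ} (hF : ConvexOn ℝ S F)
    (hd : ∀ x ∈ S, DifferentiableAt ℝ F x) : ContinuousOn (deriv F) S := by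
  intro x hx
  refine ContinuousAt.continuousWithinAt ?_
  have hslope : ∀ y, y ≠ x → Filter.Tendsto (fun z => slope F z y) (nhds x)
      (nhds (slope F x y)) := fun y hy => by
    simp only [slope_def_field]
    have h1 := (hd x hx).continuousAt
    have : ContinuousAt (fun z => (F y - F z) / (y - z)) x :=
      (continuousAt_const.sub h1).div (continuousAt_const.sub continuousAt_id)
        (sub_ne_zero.2 hy)
    exact this
  have hlim := (hasDerivAt_iff_tendsto_slope.1 (hd x hx).hasDerivAt)
  rw [ContinuousAt, tendsto_order]
  constructor
  · intro r hr
    obtain ⟨y, hys, hyr, hyx⟩ : ∃ y ∈ S, r < slope F x y ∧ y < x := by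
      have h1 : ∀ᶠ y in nhdsWithin x (Set.Iio x), r < slope F x y :=
        (hlim.mono_left (nhdsWithin_mono x fun y hy => ne_of_lt hy)).eventually_const_lt hr
      have h2 : ∀ᶠ y in nhdsWithin x (Set.Iio x), y ∈ S := nhdsWithin_le_nhds (hS.mem_nhds hx)
      obtain ⟨y, hy⟩ := (h2.and (h1.and self_mem_nhdsWithin)).exists
      exact ⟨y, hy.1, hy.2.1, hy.2.2⟩
    filter_upwards [(hslope y hyx.ne).eventually_const_lt hyr, hS.mem_nhds hx,
      lt_mem_nhds hyx] with z hz hzs hyz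
    rw [slope_comm] at hz
    exact hz.trans_le (hF.slope_le_deriv hys hzs hyz (hd z hzs))
  · intro r hr
    obtain ⟨y, hys, hyr, hyx⟩ : ∃ y ∈ S, slope F x y < r ∧ x < y := by
      have h1 : ∀ᶠ y in nhdsWithin x (Set.Ioi x), slope F x y < r :=
        (hlim.mono_left (nhdsWithin_mono x fun y hy => ne_of_gt hy)).eventually_lt_const hr
      have h2 : ∀ᶠ y in nhdsWithin x (Set.Ioi x), y ∈ S := nhdsWithin_le_nhds (hS.mem_nhds hx)
      obtain ⟨y, hy⟩ := (h2.and (h1.and self_mem_nhdsWithin)).exists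
      exact ⟨y, hy.1, hy.2.1, hy.2.2⟩
    filter_upwards [(hslope y hyx.ne').eventually_lt_const hyr, hS.mem_nhds hx,
      gt_mem_nhds hyx] with z hz hzs hyz
    exact (hF.deriv_le_slope hzs hys hyz (hd z hzs)).trans_lt hz

variable [Fintype E] [DecidableEq E] {P : Finset (List E)} {c : E → ℝ → ℝ} {Vstar : ℝ → ℝ}

theorem convexOn_optimalValue (hc_conv : ∀ e, ConvexOn ℝ (Set.Ici 0) (fun t => t * c e t))
    (hVstar : ∀ μ : ℝ, 0 ≤ μ →
      IsLeast {y | ∃ f, gFeasible P f μ ∧ y = gSocialCost P c f} (Vstar μ)) :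
    ConvexOn ℝ (Set.Ioi 0) Vstar := by
  refine ⟨convex_Ioi 0, fun x hx y hy s t hs ht hst => ?_⟩
  obtain ⟨f, hf, hfv⟩ := (hVstar x (le_of_lt hx)).1
  obtain ⟨g, hg, hgv⟩ := (hVstar y (le_of_lt hy)).1
  have hx' : 0 < x := hx
  have hy' : 0 < y := hy
  simp only [smul_eq_mul]
  refine ((hVstar (s * x + t * y) (by positivity)).2
    ⟨_, hf.convex_comb hg hs ht, rfl⟩).trans ?_
  rw [hfv, hgv, gSocialCost, gSocialCost, gSocialCost, Finset.mul_sum, Finset.mul_sum,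
    ← Finset.sum_add_distrib]
  refine Finset.sum_le_sum fun e _ => ?_
  rw [gLoad_linear_comb]
  exact (hc_conv e).2 (gLoad_nonneg hf.1 e) (gLoad_nonneg hg.1 e) hs ht hst

theorem differentiableAt_optimalValue (hc : ∀ e, Differentiable ℝ (c e))
    (hc_conv : ∀ e, ConvexOn ℝ (Set.Ici 0) (fun t => t * c e t))
    (hVstar : ∀ μ : ℝ, 0 ≤ μ →
      IsLeast {y | ∃ f, gFeasible P f μ ∧ y = gSocialCost P c f} (Vstar μ))
    {μ : ℝ} (hμ : 0 < μ) : DifferentiableAt ℝ Vstar μ := by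
  obtain ⟨f, hf, hfv⟩ := (hVstar μ hμ.le).1
  obtain ⟨q, hq, hfq⟩ : ∃ q ∈ P, 0 < f q := by
    by_contra! hcon
    have := Finset.sum_nonpos hcon
    rw [hf.2] at this
    linarith
  let ind : List E → ℝ := fun p => if p = q then 1 else 0
  let G : ℝ → ℝ := fun y => gSocialCost P c (fun p => 1 * f p + (y - μ) * ind p)
  have hG : DifferentiableAt ℝ G μ := by
    simp only [G, gSocialCost, gLoad_linear_comb]
    have hlin : ∀ e, DifferentiableAt ℝ
        (fun y : ℝ => 1 * gLoad P f e + (y - μ) * gLoad P ind e) μ := fun e => by fun_prop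
    exact DifferentiableAt.fun_sum fun e _ =>
      (hlin e).mul ((hc e _).comp μ (hlin e))
  refine ((convexOn_optimalValue hc_conv hVstar).hasDerivAt_of_eventually_le_s9
    (Ioi_mem_nhds hμ) hG.hasDerivAt ?_ ?_).differentiableAt
  · filter_upwards [Ioi_mem_nhds hμ, Ioi_mem_nhds (show μ - f q < μ by linarith)] with y hy hy'
    refine (hVstar y (le_of_lt hy)).2 ⟨_, ⟨fun p hp => ?_, ?_⟩, rfl⟩
    · have := hf.1 p hp
      have hy'' : μ - f q < y := hy'
      by_cases hpq : p = q
      · simp only [ind, hpq, if_true]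
        linarith
      · simp only [ind, hpq, if_false]
        linarith
    · rw [Finset.sum_add_distrib, ← Finset.mul_sum, ← Finset.mul_sum, hf.2]
      simp [ind, hq]
  · simp [G, hfv]

theorem contDiffOn_optimalValue (hc : ∀ e, Differentiable ℝ (c e))
    (hc_conv : ∀ e, ConvexOn ℝ (Set.Ici 0) (fun t => t * c e t))
    (hVstar : ∀ μ : ℝ, 0 ≤ μ →
      IsLeast {y | ∃ f, gFeasible P f μ ∧ y = gSocialCost P c f} (Vstar μ)) :
    ContDiffOn ℝ 1 Vstar (Set.Ioi 0) := by
  have hd : ∀ μ ∈ Set.Ioi (0 : ℝ), DifferentiableAt ℝ Vstar μ := fun μ hμ =>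
    differentiableAt_optimalValue hc hc_conv hVstar hμ
  rw [show (1 : WithTop ℕ∞) = 0 + 1 from (zero_add 1).symm,
    contDiffOn_succ_iff_deriv_of_isOpen isOpen_Ioi]
  refine ⟨fun μ hμ => (hd μ hμ).differentiableWithinAt, by simp, contDiffOn_zero.2 ?_⟩
  exact (convexOn_optimalValue hc_conv hVstar).continuousOn_deriv isOpen_Ioi hd

end OptimalValue

section EquilibriumCost

variable [Fintype E] {c : E → ℝ → ℝ}

/-- If the costs along linearly independent directions `χ i` agree at the loads `x`, then they can
be kept equal along a `C¹` family of loads indexed by the demand. -/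
theorem exists_equal_cost_family {ι : Type*} [Fintype ι] [Nonempty ι] {χ : ι → E → ℝ}
    (hχ : LinearIndependent ℝ χ) (hc : ∀ e, ContDiff ℝ 1 (c e))
    (hc' : ∀ e x, 0 < deriv (c e) x) {x : E → ℝ} {lam : ℝ}
    (hx : ∀ i, ∑ e, χ i e * c e (x e) = lam) (μ₀ : ℝ) :
    ∃ (a : ℝ → ι → ℝ) (l : ℝ → ℝ), ContinuousAt a μ₀ ∧ ContDiffAt ℝ 1 l μ₀ ∧
      a μ₀ = 0 ∧ l μ₀ = lam ∧ ∀ᶠ μ in nhds μ₀,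
        (∀ i, ∑ e, χ i e * c e (x e + ∑ j, a μ j * χ j e) = l μ) ∧ ∑ j, a μ j = μ - μ₀ := by
  let G : (ι → ℝ) × ℝ → (ι → ℝ) × ℝ := fun z =>
    (fun i => ∑ e, χ i e * c e (x e + ∑ j, z.1 j * χ j e) - z.2, ∑ j, z.1 j)
  have hG : ContDiff ℝ 1 G := by
    have hcoord : ∀ j, ContDiff ℝ 1 (fun z : (ι → ℝ) × ℝ => z.1 j) := fun j =>
      (contDiff_apply ℝ ℝ j).comp contDiff_fst
    refine ContDiff.prodMk (contDiff_pi.2 fun i => ?_) (ContDiff.sum fun j _ => hcoord j)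
    refine ContDiff.sub (ContDiff.sum fun e _ => contDiff_const.mul ((hc e).comp ?_)) contDiff_snd
    exact contDiff_const.add (ContDiff.sum fun j _ => (hcoord j).mul contDiff_const)
  have hG0 : G (0, lam) = (0, 0) := by
    simp only [G, Prod.mk.injEq]
    refine ⟨?_, by simp⟩
    funext i
    simp [hx i]
  have hderiv := (hG.differentiable one_ne_zero (0, lam)).hasFDerivAt
  have hinj : Function.Injective (fderiv ℝ G (0, lam)) := by
    rw [injective_iff_map_eq_zero]
    rintro ⟨a, l⟩ hal
    have hline : HasDerivAt (fun t : ℝ => G ((0, lam) + t • (a, l))) (0 : (ι → ℝ) × ℝ) 0 := by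
      have := hderiv.hasLineDerivAt (a, l)
      rwa [hal] at this
    have h1 := hasDerivAt_pi.1 hline.fst
    have h2 := (ContinuousLinearMap.snd ℝ (ι → ℝ) ℝ).hasFDerivAt.comp_hasDerivAt (0 : ℝ) hline
    let w : E → ℝ := fun e => ∑ j, a j * χ j e
    have h1' : ∀ i, ∑ e, χ i e * (deriv (c e) (x e) * w e) = l := fun i => by
      have hlin : ∀ e, HasDerivAt (fun t : ℝ => x e + ∑ j, t * a j * χ j e) (w e) 0 := fun e => by
        have : HasDerivAt (fun t : ℝ => x e + t * w e) (w e) 0 := by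
          simpa using ((hasDerivAt_id (0 : ℝ)).mul_const (w e)).const_add (x e)
        simpa only [w, Finset.mul_sum, mul_assoc] using this
      have hd : HasDerivAt (fun t : ℝ => ∑ e, χ i e * c e (x e + ∑ j, t * a j * χ j e)
          - (lam + t * l)) (∑ e, χ i e * (deriv (c e) (x e) * w e) - l) 0 := by
        refine HasDerivAt.sub (HasDerivAt.fun_sum fun e _ => ?_) ?_
        · refine HasDerivAt.const_mul _ (HasDerivAt.comp (0 : ℝ) ?_ (hlin e))
          have := ((hc e).differentiable one_ne_zero (x e)).hasDerivAt
          simpa using this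
        · simpa using ((hasDerivAt_id (0 : ℝ)).mul_const l).const_add lam
      have hfun : (fun t : ℝ => (G ((0, lam) + t • (a, l))).1 i) = fun t : ℝ =>
          ∑ e, χ i e * c e (x e + ∑ j, t * a j * χ j e) - (lam + t * l) := by
        funext t
        simp [G]
      have h0 := h1 i
      rw [hfun] at h0
      have := h0.unique hd
      simp only [Prod.fst_zero, Pi.zero_apply] at this
      linarith
    have h2' : ∑ j, a j = 0 := by
      have hd : HasDerivAt (fun t : ℝ => t * ∑ j, a j) (∑ j, a j) 0 := by
        simpa using (hasDerivAt_id (0 : ℝ)).mul_const (∑ j, a j)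
      refine hd.unique ?_
      simpa [G, Finset.mul_sum, Function.comp_def] using h2
    have hquad : ∑ e, deriv (c e) (x e) * w e ^ 2 = 0 := by
      calc ∑ e, deriv (c e) (x e) * w e ^ 2
          = ∑ e, ∑ i, a i * (χ i e * (deriv (c e) (x e) * w e)) := by
            refine Finset.sum_congr rfl fun e _ => ?_
            simp only [← mul_assoc, ← Finset.sum_mul]
            simp only [w]
            ring
        _ = ∑ i, a i * l := by
            rw [Finset.sum_comm]
            simp only [← Finset.mul_sum, h1']
        _ = 0 := by rw [← Finset.sum_mul, h2', zero_mul]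
    have hw : ∀ e, w e = 0 := fun e => by
      have := (Finset.sum_eq_zero_iff_of_nonneg fun e _ =>
        mul_nonneg (hc' e (x e)).le (sq_nonneg (w e))).1 hquad e (Finset.mem_univ e)
      simpa [(hc' e (x e)).ne'] using this
    have ha : a = 0 := by
      funext i
      refine Fintype.linearIndependent_iff.1 hχ a ?_ i
      funext e
      simpa [w] using hw e
    have hl : l = 0 := by
      obtain ⟨i⟩ := ‹Nonempty ι›
      rw [← h1' i]
      simp [hw]
    rw [ha, hl]
    rfl
  let L : ((ι → ℝ) × ℝ) ≃L[ℝ] ((ι → ℝ) × ℝ) :=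
    (LinearEquiv.ofInjectiveEndo (fderiv ℝ G (0, lam)).toLinearMap hinj).toContinuousLinearEquiv
  have hL : HasFDerivAt G (L : ((ι → ℝ) × ℝ) →L[ℝ] ((ι → ℝ) × ℝ)) (0, lam) := by
    have hLG : (L : ((ι → ℝ) × ℝ) →L[ℝ] ((ι → ℝ) × ℝ)) = fderiv ℝ G (0, lam) :=
      ContinuousLinearMap.ext fun _ => rfl
    rw [hLG]
    exact hderiv
  let H := (hG.contDiffAt (x := (0, lam))).localInverse hL one_ne_zero
  have hH : ContDiffAt ℝ 1 H (0, 0) := by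
    rw [← hG0]
    exact (hG.contDiffAt (x := (0, lam))).to_localInverse hL one_ne_zero
  have hH0 : H (0, 0) = (0, lam) := by
    rw [← hG0]
    exact (hG.contDiffAt (x := (0, lam))).localInverse_apply_image hL one_ne_zero
  have hHG : ∀ᶠ y in nhds ((0, 0) : (ι → ℝ) × ℝ), G (H y) = y := by
    rw [← hG0]
    exact ((hG.contDiffAt (x := (0, lam))).hasStrictFDerivAt' hL
      one_ne_zero).eventually_right_inverse
  have hz : ContDiff ℝ 1 (fun μ : ℝ => ((0 : ι → ℝ), μ - μ₀)) :=
    contDiff_const.prodMk (contDiff_id.sub contDiff_const)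
  have hz0 : ((0 : ι → ℝ), μ₀ - μ₀) = (0, 0) := by rw [sub_self]
  have hHz : ContDiffAt ℝ 1 (fun μ : ℝ => H (0, μ - μ₀)) μ₀ := by
    refine ContDiffAt.comp μ₀ ?_ hz.contDiffAt
    rwa [hz0]
  refine ⟨fun μ => (H (0, μ - μ₀)).1, fun μ => (H (0, μ - μ₀)).2, ?_, ?_, ?_, ?_, ?_⟩
  · exact hHz.continuousAt.fst
  · exact contDiff_snd.contDiffAt.comp μ₀ hHz
  · simp only [hz0, hH0]
  · simp only [hz0, hH0]
  · have htend : Filter.Tendsto (fun μ : ℝ => ((0 : ι → ℝ), μ - μ₀)) (nhds μ₀) (nhds (0, 0)) := by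
      rw [← hz0]
      exact hz.continuous.continuousAt
    filter_upwards [htend.eventually hHG] with μ hμ
    have h1 := congrArg Prod.fst hμ
    have h2 := congrArg Prod.snd hμ
    refine ⟨fun i => ?_, h2⟩
    have := congrFun h1 i
    simp only [G, Pi.zero_apply] at this
    linarith

variable [DecidableEq E] {P : Finset (List E)}

theorem exists_contDiffAt_wardropCost (hnd : ∀ p ∈ P, p.Nodup) (hne : ∀ p ∈ P, p ≠ [])
    (hc : ∀ e, ContDiff ℝ 1 (c e)) (hc_pos : ∀ e x, 0 < c e x) (hc' : ∀ e x, 0 < deriv (c e) x)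
    {μ₀ lam : ℝ} (hμ₀ : 0 < μ₀) {f : List E → ℝ} (h : gIsWardrop P c μ₀ f lam)
    (hfull : ∀ p ∈ P, gPathCost P c f p = lam → 0 < f p) :
    ∃ l : ℝ → ℝ, ContDiffAt ℝ 1 l μ₀ ∧
      ∀ᶠ μ in nhds μ₀, ∃ g, gIsWardrop P c μ g (l μ) := by
  classical
  let χ : List E → E → ℝ := fun p e => p.count e
  let A : Finset (List E) := P.filter fun p => gPathCost P c f p = lam
  obtain ⟨S, hSA, -, hspan, hli⟩ := exists_linearIndepOn_extension (K := ℝ) (v := χ)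
    (s := ∅) (t := ↑A) (linearIndepOn_empty ℝ χ) (Set.empty_subset _)
  obtain ⟨B, rfl⟩ := (A.finite_toSet.subset hSA).exists_finset_coe
  have hBA : ∀ p ∈ B, p ∈ P ∧ gPathCost P c f p = lam := fun p hp =>
    Finset.mem_filter.1 (hSA hp)
  obtain ⟨q, hq, hfq⟩ := h.exists_used hμ₀
  have hqA : q ∈ A := Finset.mem_filter.2 ⟨hq, h.2.1 q hq hfq⟩
  have hlam : 0 < lam := by
    rw [← h.2.1 q hq hfq]
    refine List.sum_pos _ ?_ (by simpa using hne q hq)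
    simp only [List.mem_map]
    rintro _ ⟨e, _, rfl⟩
    exact hc_pos e _
  have hBne : Nonempty B := by
    by_contra hcon
    have hB : B = ∅ := by simpa [Finset.eq_empty_iff_forall_notMem] using hcon
    have h0 : χ q = 0 := by
      have := hspan ⟨q, hqA, rfl⟩
      simpa [hB] using this
    have := h.2.1 q hq hfq
    rw [gPathCost, sum_map_eq_sum_count] at this
    have h0' : ∀ e, (q.count e : ℝ) = 0 := fun e => congrFun h0 e
    simp only [h0', zero_mul, Finset.sum_const_zero] at this
    exact hlam.ne this
  obtain ⟨a, l, ha, hl, ha0, hl0, hev⟩ := exists_equal_cost_family (ι := B)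
    (χ := fun p : B => χ p) hli hc hc' (x := gLoad P f) (lam := lam)
    (fun p => by
      rw [← (hBA p p.2).2, gPathCost, sum_map_eq_sum_count]) μ₀
  let g : ℝ → List E → ℝ := fun μ p => f p + if hp : p ∈ B then a μ ⟨p, hp⟩ else 0
  have hgcont : ∀ p, ContinuousAt (fun μ => g μ p) μ₀ := fun p => by
    simp only [g]
    split_ifs with hp
    · exact continuousAt_const.add ((continuousAt_apply _ _).comp ha)
    · exact continuousAt_const
  have hg0 : g μ₀ = f := by
    funext p
    simp [g, ha0]
  have hsumB : ∀ μ (w : List E → ℝ), ∑ p ∈ P, g μ p * w p =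
      ∑ p ∈ P, f p * w p + ∑ p : B, a μ p * w p := fun μ w => by
    simp only [g, add_mul, Finset.sum_add_distrib]
    congr 1
    rw [← Finset.sum_subset (fun p hp => (hBA p hp).1 : B ⊆ P), ← Finset.sum_coe_sort B]
    · exact Finset.sum_congr rfl fun p _ => by rw [dif_pos p.2]
    · intro p _ hp
      rw [dif_neg hp, zero_mul]
  have hgload : ∀ μ e, gLoad P (g μ) e = gLoad P f e + ∑ p : B, a μ p * χ p e := fun μ e => by
    rw [gLoad_eq_sum_count hnd, gLoad_eq_sum_count hnd, hsumB]
  have hcostcont : ∀ p, ContinuousAt (fun μ => gPathCost P c (g μ) p) μ₀ := fun p => by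
    simp only [gPathCost, sum_map_eq_sum_count, gLoad_eq_sum_count hnd]
    refine tendsto_finsetSum _ fun e _ => ContinuousAt.mul continuousAt_const ?_
    refine ContinuousAt.comp (hc e).continuous.continuousAt ?_
    exact tendsto_finsetSum _ fun p _ => ContinuousAt.mul (hgcont p) continuousAt_const
  have hpos : ∀ᶠ μ in nhds μ₀, ∀ p ∈ A, 0 < g μ p := by
    refine (Filter.eventually_all_finset A).2 fun p hp => ?_
    refine (hgcont p).eventually_const_lt ?_
    simp only [hg0]
    exact hfull p (Finset.mem_filter.1 hp).1 (Finset.mem_filter.1 hp).2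
  have hexp : ∀ᶠ μ in nhds μ₀, ∀ p ∈ P \ A, l μ < gPathCost P c (g μ) p := by
    refine (Filter.eventually_all_finset _).2 fun p hp => ?_
    refine hl.continuousAt.eventually_lt (hcostcont p) ?_
    rw [hg0, hl0]
    obtain ⟨hpP, hpA⟩ := Finset.mem_sdiff.1 hp
    exact (h.2.2 p hpP).lt_of_ne fun heq => hpA (Finset.mem_filter.2 ⟨hpP, heq.symm⟩)
  refine ⟨l, hl, ?_⟩
  filter_upwards [hev, hpos, hexp] with μ hμ hμpos hμexp
  have hcostA : ∀ p ∈ A, gPathCost P c (g μ) p = l μ := by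
    let Λ : (E → ℝ) →ₗ[ℝ] ℝ :=
      ∑ e, (c e (gLoad P (g μ) e) - l μ / lam * c e (gLoad P f e)) • LinearMap.proj e
    have hΛ : ∀ p, gPathCost P c f p = lam → Λ (χ p) = gPathCost P c (g μ) p - l μ := by
      intro p hp
      have : l μ = l μ / lam * gPathCost P c f p := by
        rw [hp, div_mul_cancel₀ _ hlam.ne']
      rw [this]
      simp only [Λ, χ, gPathCost, sum_map_eq_sum_count, LinearMap.sum_apply, LinearMap.smul_apply,
        LinearMap.proj_apply, smul_eq_mul, Finset.mul_sum, ← Finset.sum_sub_distrib]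
      refine Finset.sum_congr rfl fun e _ => ?_
      ring
    have hker : Submodule.span ℝ (χ '' B) ≤ LinearMap.ker Λ := by
      rw [Submodule.span_le]
      rintro _ ⟨p, hp, rfl⟩
      rw [SetLike.mem_coe, LinearMap.mem_ker, hΛ p (hBA p hp).2, sub_eq_zero, gPathCost,
        sum_map_eq_sum_count]
      simp only [hgload]
      exact hμ.1 ⟨p, hp⟩
    intro p hp
    have hz : Λ (χ p) = 0 := hker (hspan ⟨p, hp, rfl⟩)
    rw [hΛ p (Finset.mem_filter.1 hp).2] at hz
    exact sub_eq_zero.1 hz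
  have hgA : ∀ p ∈ P, p ∉ A → g μ p = 0 := fun p hp hpA => by
    have hpB : p ∉ B := fun hpB => hpA (hSA hpB)
    have hf0 : f p = 0 := by
      refine le_antisymm ?_ (h.1.1 p hp)
      by_contra! hlt
      exact hpA (Finset.mem_filter.2 ⟨hp, h.2.1 p hp hlt⟩)
    simp [g, hpB, hf0]
  refine ⟨g μ, ⟨fun p hp => ?_, ?_⟩, fun p hp hgp => ?_, fun p hp => ?_⟩
  · by_cases hpA : p ∈ A
    · exact (hμpos p hpA).le
    · exact (hgA p hp hpA).ge
  · have := hsumB μ fun _ => 1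
    simp only [mul_one] at this
    rw [this, h.1.2, hμ.2]
    ring
  · by_cases hpA : p ∈ A
    · exact hcostA p hpA
    · exact absurd (hgA p hp hpA) hgp.ne'
  · by_cases hpA : p ∈ A
    · exact (hcostA p hpA).ge
    · exact (hμexp p (Finset.mem_sdiff.2 ⟨hp, hpA⟩)).le

end EquilibriumCost

/-- in a single origin–destination network with C¹ costs having strictly
positive derivative, `t·c_e(t)` convex on `[0,∞)`, and `V*(μ) > 0` for all `μ > 0`,
the price of anarchy `μ ↦ μ·λ(μ)/V*(μ)` is continuously differentiable in a
neighborhood of every regular demand `μ₀ > 0`. -/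
theorem PoA_C1_at_regular_demand
    [Fintype E] [DecidableEq E] [Fintype V] [DecidableEq V]
    (src tgt : E → V) (O D : V) (hOD : O ≠ D)
    (P : Finset (List E))
    (hP : ∀ es, es ∈ P ↔ IsSimplePathFrom src tgt O D es)
    (hPne : P.Nonempty)
    (c : E → ℝ → ℝ)
    (hc_C1 : ∀ e, ContDiff ℝ 1 (c e))
    (hc_nonneg : ∀ e x, 0 ≤ c e x)
    (hc_deriv : ∀ e x, 0 < deriv (c e) x)
    (hc_conv : ∀ e, ConvexOn ℝ (Set.Ici 0) (fun t => t * c e t))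
    (feq : ℝ → List E → ℝ) (lamf : ℝ → ℝ)
    (hfeq : ∀ μ : ℝ, 0 < μ → gIsWardrop P c μ (feq μ) (lamf μ))
    (Vstar : ℝ → ℝ)
    (hVstar : ∀ μ : ℝ, 0 ≤ μ →
      IsLeast {y | ∃ f, gFeasible P f μ ∧ y = gSocialCost P c f} (Vstar μ))
    (hVpos : ∀ μ : ℝ, 0 < μ → 0 < Vstar μ)
    (μ₀ : ℝ) (hμ₀ : 0 < μ₀) (hreg : gRegular P c μ₀) :
    ∃ ε > 0, 0 < μ₀ - ε ∧
      ContDiffOn ℝ 1 (fun μ => μ * lamf μ / Vstar μ)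
        (Set.Ioo (μ₀ - ε) (μ₀ + ε)) := by
  have hc_mono : ∀ e, StrictMono (c e) := fun e => strictMono_of_deriv_pos (hc_deriv e)
  have hc_pos : ∀ e x, 0 < c e x := fun e x =>
    (hc_nonneg e (x - 1)).trans_lt (hc_mono e (sub_one_lt x))
  have hnd : ∀ p ∈ P, p.Nodup := fun p hp => ((hP p).1 hp).nodup
  have hne : ∀ p ∈ P, p ≠ [] := fun p hp => ((hP p).1 hp).1.1
  obtain ⟨f, lam, hf, hact⟩ := hreg
  obtain ⟨g, hg, hfull⟩ := hf.exists_full_support hOD hP hc_pos hμ₀ hact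
  obtain ⟨l, hl, hev⟩ :=
    exists_contDiffAt_wardropCost hnd hne hc_C1 hc_pos hc_deriv hμ₀ hg hfull
  have hlamf : lamf =ᶠ[nhds μ₀] l := by
    filter_upwards [hev, Ioi_mem_nhds hμ₀] with μ hμ hμpos
    obtain ⟨k, hk⟩ := hμ
    exact (hfeq μ hμpos).cost_unique hnd hc_mono hμpos hk
  have hV := contDiffOn_optimalValue (fun e => (hc_C1 e).differentiable one_ne_zero)
    hc_conv hVstar
  have hPoA : ContDiffAt ℝ 1 (fun μ => μ * lamf μ / Vstar μ) μ₀ :=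
    (contDiffAt_id.mul (hl.congr_of_eventuallyEq hlamf)).div
      (hV.contDiffAt (Ioi_mem_nhds hμ₀)) (hVpos μ₀ hμ₀).ne'
  have hnear := (hPoA.eventually (by simp)).and (Ioi_mem_nhds hμ₀)
  obtain ⟨ε, hε, hball⟩ := Metric.eventually_nhds_iff_ball.1 hnear
  rw [Real.ball_eq_Ioo] at hball
  refine ⟨ε / 2, by positivity, ?_, fun μ hμ => ?_⟩
  · exact (hball (μ₀ - ε / 2) ⟨by linarith, by linarith⟩).2
  · exact (hball μ ⟨by linarith [hμ.1], by linarith [hμ.2]⟩).1.contDiffWithinAt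
end
end

section
/- Let λ¹, λ² : [0,∞) → ℝ be continuous and nondecreasing. For μ ≥ 0 define g(μ) = inf { x ∈ [0,μ] : λ¹(x) ≥ λ²(μ−x) }, with the convention g(μ) = μ when this set is empty. Then both g and μ ↦ μ − g(μ) are nondecreasing on [0,∞). -/
open Set

/-- for continuous nondecreasing `λ¹, λ²` on `[0,∞)`, the splitting function
`g(μ) = inf {x ∈ [0,μ] : λ¹(x) ≥ λ²(μ−x)}` (with `g(μ) = μ` when this set is empty)
and `μ ↦ μ − g(μ)` are both nondecreasing on `[0,∞)`. -/
theorem splitting_function_monotone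
    (l1 l2 : ℝ → ℝ)
    (h1c : ContinuousOn l1 (Set.Ici 0)) (h2c : ContinuousOn l2 (Set.Ici 0))
    (h1m : MonotoneOn l1 (Set.Ici 0)) (h2m : MonotoneOn l2 (Set.Ici 0))
    (g : ℝ → ℝ)
    (hg_inf : ∀ μ : ℝ, 0 ≤ μ → (∃ x ∈ Set.Icc 0 μ, l2 (μ - x) ≤ l1 x) →
      g μ = sInf {x | x ∈ Set.Icc 0 μ ∧ l2 (μ - x) ≤ l1 x})
    (hg_empty : ∀ μ : ℝ, 0 ≤ μ → (¬ ∃ x ∈ Set.Icc 0 μ, l2 (μ - x) ≤ l1 x) →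
      g μ = μ) :
    MonotoneOn g (Set.Ici 0) ∧ MonotoneOn (fun μ => μ - g μ) (Set.Ici 0) := by
  have g_le : ∀ μ, 0 ≤ μ → ∀ x ∈ Icc 0 μ, l2 (μ - x) ≤ l1 x → g μ ≤ x := by
    intro μ hμ x hx hlx
    rw [hg_inf μ hμ ⟨x, hx, hlx⟩]
    exact csInf_le ⟨0, fun _ hy => hy.1.1⟩ ⟨hx, hlx⟩
  have le_g : ∀ μ, 0 ≤ μ → ∀ c ≤ μ, (∀ x ∈ Icc 0 μ, l2 (μ - x) ≤ l1 x → c ≤ x) → c ≤ g μ := by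
    intro μ hμ c hc hlb
    by_cases hne : ∃ x ∈ Icc 0 μ, l2 (μ - x) ≤ l1 x
    · rw [hg_inf μ hμ hne]
      exact le_csInf hne fun x hx => hlb x hx.1 hx.2
    · rwa [hg_empty μ hμ hne]
  have g_le_self : ∀ μ, 0 ≤ μ → g μ ≤ μ := by
    intro μ hμ
    by_cases hne : ∃ x ∈ Icc 0 μ, l2 (μ - x) ≤ l1 x
    · obtain ⟨x, hx, hlx⟩ := hne
      exact (g_le μ hμ x hx hlx).trans hx.2
    · exact (hg_empty μ hμ hne).le
  refine ⟨fun μ hμ ν hν hμν => ?_, fun μ hμ ν hν hμν => ?_⟩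
  · refine le_g ν hν _ ((g_le_self μ hμ).trans hμν) fun x hx hlx => ?_
    rcases le_total μ x with hμx | hxμ
    · exact (g_le_self μ hμ).trans hμx
    · exact g_le μ hμ x ⟨hx.1, hxμ⟩
        ((h2m (sub_nonneg.2 hxμ) (sub_nonneg.2 hx.2) (by linarith)).trans hlx)
  · have shift : g ν - (ν - μ) ≤ g μ := by
      refine le_g μ hμ _ (by linarith [g_le_self ν hν]) fun x hx hlx => ?_
      have hx_le : x ≤ x + (ν - μ) := by linarith
      have hx_shift : 0 ≤ x + (ν - μ) := hx.1.trans hx_le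
      refine sub_le_iff_le_add.2 (g_le ν hν _ ⟨hx_shift, by linarith [hx.2]⟩ ?_)
      rw [show ν - (x + (ν - μ)) = μ - x by ring]
      exact hlx.trans (h1m hx.1 hx_shift hx_le)
    change μ - g μ ≤ ν - g ν
    linarith
end

section
/- Let α, β, δ, η be nonnegative reals and γ ≤ 0, and let I ⊆ (0,∞) be an interval on which q(μ) = γ + δ·μ + η·μ² > 0. Define r(μ) = (α·μ + β·μ²)/q(μ) for μ ∈ I. Then either r is monotone on I (nonincreasing on I or nondecreasing on I), or there exists μ* in the interior of I such that r is nonincreasing on I ∩ (0, μ*] and nondecreasing on I ∩ [μ*, ∞). In particular r has no strict local maximum in the interior of I. -/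
open Set

/-- If `a, b ≤ 0`, then `(a + b (x + y) + d x y) / (x y)` is nondecreasing in the positive
variables `x` and `y`. -/
theorem bilinear_mul_le_mul {a b d x y x' y' : ℝ} (ha : a ≤ 0) (hb : b ≤ 0)
    (hx : 0 < x) (hy : 0 < y) (hxx : x ≤ x') (hyy : y ≤ y') :
    (a + b * (x + y) + d * (x * y)) * (x' * y') ≤
      (a + b * (x' + y') + d * (x' * y')) * (x * y) := by
  have hx' : 0 < x' := hx.trans_le hxx
  have hy' : 0 < y' := hy.trans_le hyy
  have hxy : 0 ≤ -a * (x' * y' - x * y) :=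
    mul_nonneg (neg_nonneg.2 ha) (sub_nonneg.2 (mul_le_mul hxx hyy hy.le hx'.le))
  have hxb : 0 ≤ -b * (x * x' * (y' - y) + y * y' * (x' - x)) :=
    mul_nonneg (neg_nonneg.2 hb) (add_nonneg
      (mul_nonneg (mul_pos hx hx').le (sub_nonneg.2 hyy))
      (mul_nonneg (mul_pos hy hy').le (sub_nonneg.2 hxx)))
  linarith

theorem bilinear_nonpos_of_le {a b d x y x' y' : ℝ} (ha : a ≤ 0) (hb : b ≤ 0)
    (hx : 0 < x) (hy : 0 < y) (hxx : x ≤ x') (hyy : y ≤ y')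
    (h : a + b * (x' + y') + d * (x' * y') ≤ 0) : a + b * (x + y) + d * (x * y) ≤ 0 := by
  have hpos : 0 < x' * y' := mul_pos (hx.trans_le hxx) (hy.trans_le hyy)
  exact nonpos_of_mul_nonpos_left ((bilinear_mul_le_mul ha hb hx hy hxx hyy).trans
    (mul_nonpos_of_nonpos_of_nonneg h (mul_pos hx hy).le)) hpos

theorem bilinear_nonneg_of_le {a b d x y x' y' : ℝ} (ha : a ≤ 0) (hb : b ≤ 0)
    (hx : 0 < x) (hy : 0 < y) (hxx : x ≤ x') (hyy : y ≤ y')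
    (h : 0 ≤ a + b * (x + y) + d * (x * y)) : 0 ≤ a + b * (x' + y') + d * (x' * y') := by
  have hpos : 0 < x' * y' := mul_pos (hx.trans_le hxx) (hy.trans_le hyy)
  exact nonneg_of_mul_nonneg_left ((mul_nonneg h hpos.le).trans
    (bilinear_mul_le_mul ha hb hx hy hxx hyy)) (mul_pos hx hy)

/-- A function that is antitone, monotone, or antitone and then monotone on `I` has no strict
local maximum in the interior of `I`. -/
theorem not_strict_local_max_of_antitoneOn_monotoneOn {I : Set ℝ} {r : ℝ → ℝ}
    (h : AntitoneOn r I ∨ MonotoneOn r I ∨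
      ∃ m ∈ interior I, AntitoneOn r (I ∩ Iic m) ∧ MonotoneOn r (I ∩ Ici m))
    {c : ℝ} (hc : c ∈ interior I) :
    ¬ ∃ ε > 0, ∀ x ∈ I, x ∈ Ioo (c - ε) (c + ε) → x ≠ c → r x < r c := by
  rintro ⟨ε, hε, hmax⟩
  obtain ⟨ρ, hρ, hball⟩ := Metric.isOpen_iff.1 isOpen_interior c hc
  rw [Real.ball_eq_Ioo] at hball
  obtain ⟨t, ht, htmin⟩ := exists_between (lt_min hε hρ)
  obtain ⟨htε, htρ⟩ := lt_min_iff.1 htmin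
  have hcI : c ∈ I := interior_subset hc
  have hlI : c - t ∈ I := interior_subset (hball ⟨by linarith, by linarith⟩)
  have hrI : c + t ∈ I := interior_subset (hball ⟨by linarith, by linarith⟩)
  have hl : r (c - t) < r c := hmax _ hlI ⟨by linarith, by linarith⟩ (by linarith)
  have hr : r (c + t) < r c := hmax _ hrI ⟨by linarith, by linarith⟩ (by linarith)
  have hlc : c - t ≤ c := by linarith
  have hcr : c ≤ c + t := by linarith
  rcases h with h | h | ⟨m, -, hanti, hmono⟩
  · exact hl.not_ge (h hlI hcI hlc)
  · exact hr.not_ge (h hcI hrI hcr)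
  · rcases le_total c m with hcm | hmc
    · exact hl.not_ge (hanti ⟨hlI, hlc.trans hcm⟩ ⟨hcI, hcm⟩ hlc)
    · exact hr.not_ge (hmono ⟨hcI, hmc⟩ ⟨hrI, hmc.trans hcr⟩ hcr)

/-- for `α, β, δ, η ≥ 0`, `γ ≤ 0`, on an interval `I ⊆ (0,∞)` where
`q(μ) = γ + δμ + ημ² > 0`, the function `r(μ) = (αμ + βμ²)/q(μ)` is either monotone on
`I`, or nonincreasing up to some interior point `μ*` and nondecreasing afterwards; in
particular `r` has no strict local maximum in the interior of `I`. -/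
theorem rational_quadratic_unimodal
    (α β δ η γ : ℝ)
    (hα : 0 ≤ α) (hβ : 0 ≤ β) (hδ : 0 ≤ δ) (hη : 0 ≤ η) (hγ : γ ≤ 0)
    (I : Set ℝ) (hne : I.Nonempty) (hI : I.OrdConnected) (hIpos : I ⊆ Set.Ioi 0)
    (hq : ∀ μ ∈ I, 0 < γ + δ * μ + η * μ ^ 2)
    (r : ℝ → ℝ)
    (hr : ∀ μ ∈ I, r μ = (α * μ + β * μ ^ 2) / (γ + δ * μ + η * μ ^ 2)) :
    (AntitoneOn r I ∨ MonotoneOn r I ∨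
      ∃ μs ∈ interior I,
        AntitoneOn r (I ∩ Set.Iic μs) ∧ MonotoneOn r (I ∩ Set.Ici μs)) ∧
    ∀ μ₀ ∈ interior I, ¬ ∃ ε > 0, ∀ μ ∈ I,
      μ ∈ Set.Ioo (μ₀ - ε) (μ₀ + ε) → μ ≠ μ₀ → r μ < r μ₀ := by
  have ha : α * γ ≤ 0 := mul_nonpos_of_nonneg_of_nonpos hα hγ
  have hb : β * γ ≤ 0 := mul_nonpos_of_nonneg_of_nonpos hβ hγ
  set a := α * γ with ha_def
  set b := β * γ with hb_def
  set d := β * δ - α * η with hd_def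
  have anti_step : ∀ x ∈ I, ∀ y ∈ I, x ≤ y → a + b * (x + y) + d * (x * y) ≤ 0 →
      r y ≤ r x := by
    intro x hx y hy hxy h
    rw [hr x hx, hr y hy, div_le_div_iff₀ (hq y hy) (hq x hx)]
    have := mul_nonneg (sub_nonneg.2 hxy) (neg_nonneg.2 h)
    simp only [ha_def, hb_def, hd_def] at this
    linarith
  have mono_step : ∀ x ∈ I, ∀ y ∈ I, x ≤ y → 0 ≤ a + b * (x + y) + d * (x * y) →
      r x ≤ r y := by
    intro x hx y hy hxy h
    rw [hr x hx, hr y hy, div_le_div_iff₀ (hq x hx) (hq y hy)]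
    have := mul_nonneg (sub_nonneg.2 hxy) h
    simp only [ha_def, hb_def, hd_def] at this
    linarith
  have hshape : AntitoneOn r I ∨ MonotoneOn r I ∨
      ∃ μs ∈ interior I, AntitoneOn r (I ∩ Iic μs) ∧ MonotoneOn r (I ∩ Ici μs) := by
    by_cases hneg : ∀ x ∈ I, a + b * (x + x) + d * (x * x) ≤ 0
    · exact Or.inl fun x hx y hy hxy => anti_step x hx y hy hxy
        (bilinear_nonpos_of_le ha hb (hIpos hx) (hIpos hy) hxy le_rfl (hneg y hy))
    by_cases hpos : ∀ x ∈ I, 0 ≤ a + b * (x + x) + d * (x * x)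
    · exact Or.inr (Or.inl fun x hx y hy hxy => mono_step x hx y hy hxy
        (bilinear_nonneg_of_le ha hb (hIpos hx) (hIpos hx) le_rfl hxy (hpos x hx)))
    push Not at hneg hpos
    obtain ⟨s, hs, hgs⟩ := hneg
    obtain ⟨p, hp, hgp⟩ := hpos
    have hps : p ≤ s := by
      by_contra! hsp
      exact hgp.not_ge
        (bilinear_nonneg_of_le ha hb (hIpos hs) (hIpos hs) hsp.le hsp.le hgs.le)
    have hcont : ContinuousOn (fun x : ℝ => a + b * (x + x) + d * (x * x)) (Icc p s) := by
      fun_prop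
    obtain ⟨m, hm, hgm⟩ := intermediate_value_Ioo hps hcont ⟨hgp, hgs⟩
    have hmpos : 0 < m := (hIpos hp : 0 < p).trans hm.1
    refine Or.inr (Or.inr ⟨m, ?_, ?_, ?_⟩)
    · exact interior_maximal (Ioo_subset_Icc_self.trans (hI.out hp hs)) isOpen_Ioo hm
    · exact fun x hx y hy hxy => anti_step x hx.1 y hy.1 hxy
        (bilinear_nonpos_of_le ha hb (hIpos hx.1) (hIpos hy.1) hx.2 hy.2 hgm.le)
    · exact fun x hx y hy hxy => mono_step x hx.1 y hy.1 hxy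
        (bilinear_nonneg_of_le ha hb hmpos hmpos hx.2 hy.2 hgm.ge)
  exact ⟨hshape, fun _ hμ₀ => not_strict_local_max_of_antitoneOn_monotoneOn hshape hμ₀⟩
end
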